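/- arXiv:2509.06020 — 5 statements merged into one kernel-verified Lean document; each statement's English description precedes it below -/
import Mathlib

section
/- Let g : ℝ → ℝ be continuous, one-sided Lipschitz on every compact interval, with limsup_{η→+∞} g(η)/η < ∞ and limsup_{η→−∞} g(η)/η < ∞, and let ū(t,s) denote the unique forward solution of dū/dt = g(ū), ū(0,s) = s. Then for every t ≥ 0 and every s ∈ ℝ with g(s) ≠ 0, the partial derivative ∂ū/∂s(t,s) exists and equals g(ū(t,s))/g(s). -/
open Set Filter

noncomputable section

/-- `u` is a forward solution on `[0,∞)` of the ODE `u' = g(u)` with `u(0) = s`. -/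
def IsForwardSol (g : ℝ → ℝ) (s : ℝ) (u : ℝ → ℝ) : Prop :=
  u 0 = s ∧ ∀ t ∈ Set.Ici (0:ℝ), HasDerivWithinAt u (g (u t)) (Set.Ici 0) t

/-- `g` is one-sided (right-) Lipschitz on every compact interval. -/
def OSLCompact (g : ℝ → ℝ) : Prop :=
  ∀ a b : ℝ, a < b → ∃ L : ℝ, ∀ w ∈ Set.Icc a b, ∀ z ∈ Set.Icc a b,
    w ≠ z → (g w - g z) / (w - z) ≤ L

/-- `limsup_{η → +∞} g(η)/η < ∞` and `limsup_{η → -∞} g(η)/η < ∞`. -/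
def SublinearLimsup (g : ℝ → ℝ) : Prop :=
  (∃ C : ℝ, ∀ᶠ η in Filter.atTop, g η / η ≤ C) ∧
  (∃ C : ℝ, ∀ᶠ η in Filter.atBot, g η / η ≤ C)

lemma fs_hasDerivAt {g : ℝ → ℝ} {s : ℝ} {u : ℝ → ℝ} (hu : IsForwardSol g s u) {t : ℝ}
    (ht : 0 < t) : HasDerivAt u (g (u t)) t :=
  (hu.2 t ht.le).hasDerivAt (Ici_mem_nhds ht)

lemma fs_continuousOn {g : ℝ → ℝ} {s : ℝ} {u : ℝ → ℝ} (hu : IsForwardSol g s u) :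
    ContinuousOn u (Set.Ici 0) := fun t ht => (hu.2 t ht).continuousWithinAt

lemma fs_shift {g : ℝ → ℝ} {s : ℝ} {u : ℝ → ℝ} (hu : IsForwardSol g s u) {r : ℝ}
    (hr : 0 ≤ r) : IsForwardSol g (u r) (fun t => u (t + r)) := by
  refine ⟨by simp, fun t ht => ?_⟩
  have ht' : (0:ℝ) ≤ t := ht
  have h1 := hu.2 (t + r) (by simp; linarith)
  have h2 : HasDerivWithinAt (fun t : ℝ => t + r) 1 (Set.Ici 0) t :=
    ((hasDerivAt_id t).add_const r).hasDerivWithinAt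
  have := HasDerivWithinAt.comp t h1 h2 (by
    intro x hx
    have hx' : (0:ℝ) ≤ x := hx
    simp; linarith)
  simpa [Function.comp_def] using this

lemma fs_unique {g : ℝ → ℝ} (hOSL : OSLCompact g) {s : ℝ} {u v : ℝ → ℝ}
    (hu : IsForwardSol g s u) (hv : IsForwardSol g s v) {T : ℝ} (hT : 0 ≤ T) : u T = v T := by
  have hsub : Set.Icc 0 T ⊆ Set.Ici (0:ℝ) := Set.Icc_subset_Ici_self
  have cu := (fs_continuousOn hu).mono hsub
  have cv := (fs_continuousOn hv).mono hsub
  obtain ⟨A, hA⟩ := isCompact_Icc.exists_bound_of_continuousOn cu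
  obtain ⟨B, hB⟩ := isCompact_Icc.exists_bound_of_continuousOn cv
  set M := |A| + |B| + 1 with hM
  have hMp : 0 < M := by positivity
  obtain ⟨L, hL⟩ := hOSL (-M) M (by linarith)
  have mu : ∀ t ∈ Set.Icc 0 T, u t ∈ Set.Icc (-M) M := fun t ht => by
    have := hA t ht
    rw [Real.norm_eq_abs] at this
    have h3 := le_abs_self A
    have h4 := abs_nonneg B
    exact abs_le.1 (by linarith)
  have mv : ∀ t ∈ Set.Icc 0 T, v t ∈ Set.Icc (-M) M := fun t ht => by
    have := hB t ht
    rw [Real.norm_eq_abs] at this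
    have h3 := le_abs_self B
    have h4 := abs_nonneg A
    exact abs_le.1 (by linarith)
  have key : ∀ t ∈ Set.Icc 0 T, (u t - v t) * (g (u t) - g (v t)) ≤ L * (u t - v t) ^ 2 := by
    intro t ht
    by_cases h : u t = v t
    · simp [h]
    · have h1 := hL _ (mu t ht) _ (mv t ht) h
      have h2 : u t - v t ≠ 0 := sub_ne_zero.2 h
      have h3 : (u t - v t) * (g (u t) - g (v t))
          = (g (u t) - g (v t)) / (u t - v t) * (u t - v t) ^ 2 := by field_simp
      rw [h3]
      exact mul_le_mul_of_nonneg_right h1 (sq_nonneg _)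
  let w : ℝ → ℝ := fun t => Real.exp (-(2 * L) * t) * (u t - v t) ^ 2
  have hw : ∀ t, 0 < t → HasDerivAt w
      (Real.exp (-(2 * L) * t) * (2 * ((u t - v t) * (g (u t) - g (v t)) - L * (u t - v t) ^ 2))) t := by
    intro t ht
    have h1 := ((fs_hasDerivAt hu ht).sub (fs_hasDerivAt hv ht)).pow 2
    have h2 : HasDerivAt (fun t : ℝ => Real.exp (-(2 * L) * t)) (Real.exp (-(2 * L) * t) * (-(2 * L) * 1)) t :=
      ((hasDerivAt_id t).const_mul (-(2 * L))).exp
    refine (h2.mul h1).congr_deriv ?_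
    simp only [Pi.sub_apply, Pi.pow_apply]
    push_cast
    ring
  have hanti : AntitoneOn w (Set.Icc 0 T) := by
    apply antitoneOn_of_deriv_nonpos (convex_Icc 0 T)
    · exact ContinuousOn.mul (by fun_prop) ((cu.sub cv).pow 2)
    · intro t ht
      rw [interior_Icc] at ht
      exact (hw t ht.1).differentiableAt.differentiableWithinAt
    · intro t ht
      rw [interior_Icc] at ht
      rw [(hw t ht.1).deriv]
      have := key t ⟨ht.1.le, ht.2.le⟩
      exact mul_nonpos_of_nonneg_of_nonpos (Real.exp_pos _).le (by linarith)
  have h := hanti (Set.left_mem_Icc.2 hT) (Set.right_mem_Icc.2 hT) hT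
  have h0 : w 0 = 0 := by simp [w, hu.1, hv.1]
  rw [h0] at h
  have h5 : (u T - v T) ^ 2 ≤ 0 := by
    by_contra hc
    push Not at hc
    have : 0 < w T := mul_pos (Real.exp_pos _) hc
    linarith
  have h6 : u T - v T = 0 := by
    have := le_antisymm h5 (sq_nonneg _)
    exact pow_eq_zero_iff (two_ne_zero) |>.1 this
  linarith

lemma fs_reach_pos {g : ℝ → ℝ} (hg : Continuous g) {s : ℝ} (hs : 0 < g s) :
    ∃ s₀, ∀ v, IsForwardSol g s₀ v → ∃ t₀, 0 < t₀ ∧ v t₀ = s := by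
  set m := g s / 2 with hm
  have hm0 : 0 < m := by positivity
  have hev : ∀ᶠ x in nhds s, m < g x :=
    hg.continuousAt.eventually (lt_mem_nhds (by linarith))
  obtain ⟨δ, hδ, hball⟩ := Metric.eventually_nhds_iff.1 hev
  set d := δ / 2 with hd
  have hd0 : 0 < d := by positivity
  have hgm : ∀ x, s - d ≤ x → x ≤ s → m < g x := fun x h1 h2 => by
    apply hball
    rw [Real.dist_eq, abs_lt]
    constructor <;> linarith
  refine ⟨s - d, fun v hv => ?_⟩
  have hT : 0 ≤ d / m := by positivity
  have cv : ContinuousOn v (Set.Icc 0 (d / m)) :=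
    (fs_continuousOn hv).mono Set.Icc_subset_Ici_self
  have hbar : ∀ ⦃x⦄, x ∈ Set.Icc 0 (d / m) → (fun t => s - d + m * t) x ≤ v x := by
    have hB : ∀ x : ℝ, HasDerivAt (fun t => s - d + m * t) m x := fun x => by
      have h1 : HasDerivAt (fun t : ℝ => m * t) (m * 1) x := (hasDerivAt_id x).const_mul m
      simpa using h1.const_add (s - d)
    refine image_le_of_deriv_right_lt_deriv_boundary' (f' := fun _ => m) (B' := fun t => g (v t))
      (by fun_prop) (fun x _ => (hB x).hasDerivWithinAt) (by simp [hv.1]) cv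
      (fun x hx => (hv.2 x hx.1).mono (Set.Ici_subset_Ici.2 hx.1)) ?_
    intro x hx hxe
    have h1 : m * x ≤ d := by
      have := (le_div_iff₀ hm0).1 hx.2.le
      linarith
    have h2 : 0 ≤ m * x := mul_nonneg hm0.le hx.1
    exact hgm _ (by linarith) (by linarith)
  have hend := hbar (Set.right_mem_Icc.2 hT)
  have hend' : s ≤ v (d / m) := by
    have : m * (d / m) = d := by field_simp
    simp only [this] at hend
    linarith
  obtain ⟨t₀, ht₀, hvt⟩ := intermediate_value_Icc hT cv ⟨by rw [hv.1]; linarith, hend'⟩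
  refine ⟨t₀, lt_of_le_of_ne ht₀.1 ?_, hvt⟩
  rintro rfl
  rw [hv.1] at hvt
  linarith

lemma fs_reach {g : ℝ → ℝ} (hg : Continuous g) {s : ℝ} (hs : g s ≠ 0) :
    ∃ s₀, ∀ v, IsForwardSol g s₀ v → ∃ t₀, 0 < t₀ ∧ v t₀ = s := by
  rcases lt_or_gt_of_ne hs with h | h
  · obtain ⟨s₀, h0⟩ := fs_reach_pos (g := fun x => - g (-x)) (s := -s) (by fun_prop) (by simpa using h)
    refine ⟨-s₀, fun v hv => ?_⟩
    obtain ⟨t₀, h1, h2⟩ := h0 (fun t => - v t) ⟨by simp [hv.1], fun t ht => by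
      simpa using (hv.2 t ht).fun_neg⟩
    exact ⟨t₀, h1, by simpa using h2⟩
  · exact fs_reach_pos hg h

/-- formula (3.8) of the paper.  Let `ū(t,s)` be the unique forward
solution of `dū/dt = g(ū)`, `ū(0,s) = s`, where `g` is continuous, one-sided Lipschitz on
every compact interval and limsup-sublinear at `±∞`.  Then for every `t ≥ 0` and every
`s` with `g(s) ≠ 0`, the partial derivative `∂ū/∂s(t,s)` exists and equals
`g(ū(t,s))/g(s)`. -/
theorem characteristic_ODE_deriv_in_s
    (g : ℝ → ℝ) (hg : Continuous g) (hOSL : OSLCompact g) (hsub : SublinearLimsup g)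
    (ub : ℝ → ℝ → ℝ) (hub : ∀ s : ℝ, IsForwardSol g s (fun t => ub t s)) :
    ∀ t : ℝ, 0 ≤ t → ∀ s : ℝ, g s ≠ 0 →
      HasDerivAt (fun σ => ub t σ) (g (ub t s) / g s) s := by
  intro t ht s hs
  obtain ⟨s₀, h0⟩ := fs_reach hg hs
  obtain ⟨t₀, ht₀, hvs⟩ := h0 _ (hub s₀)
  have hv := hub s₀
  set v : ℝ → ℝ := fun t => ub t s₀ with hvdef
  replace hvs : v t₀ = s := hvs
  have hstrict : HasStrictDerivAt v (g s) t₀ := by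
    have := hasStrictDerivAt_of_hasDerivAt_of_continuousAt (f := v) (f' := fun τ => g (v τ)) (x := t₀)
      ((lt_mem_nhds ht₀).mono fun τ hτ => fs_hasDerivAt hv hτ)
      (hg.continuousAt.comp (fs_hasDerivAt hv ht₀).continuousAt)
    simpa only [hvs] using this
  have hloc := (hstrict.to_localInverse hs).hasDerivAt
  have hright := hstrict.hasStrictFDerivAt_equiv hs |>.eventually_right_inverse
  have himg : hstrict.localInverse v (g s) t₀ hs (v t₀) = t₀ :=
    (hstrict.hasStrictFDerivAt_equiv hs).localInverse_apply_image
  set φ := hstrict.localInverse v (g s) t₀ hs with hφ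
  have hright' : ∀ᶠ σ in nhds s, v (φ σ) = σ := by
    rw [← hvs]; exact hright
  rw [hvs] at hloc himg
  have hpos : ∀ᶠ σ in nhds s, 0 < φ σ :=
    hloc.continuousAt.eventually (by rw [himg]; exact lt_mem_nhds ht₀)
  have hrep : ∀ σ, v (φ σ) = σ → 0 < φ σ → ub t σ = v (t + φ σ) := by
    intro σ h1 h2
    have h3 := fs_shift hv h2.le
    rw [h1] at h3
    exact fs_unique hOSL (hub σ) h3 ht
  have hs1 : ub t s = v (t + φ s) := hrep s (by rw [himg]; exact hvs) (by rw [himg]; exact ht₀)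
  have hd : HasDerivAt v (g (v (t + φ s))) (t + φ s) :=
    fs_hasDerivAt hv (by rw [himg]; linarith)
  have hcomp := hd.comp s (hloc.const_add t)
  rw [← hs1, ← div_eq_mul_inv] at hcomp
  refine hcomp.congr_of_eventuallyEq ?_
  filter_upwards [hright', hpos] with σ h1 h2
  exact hrep σ h1 h2
end
end

section
/- Let g : ℝ → ℝ be continuous, one-sided Lipschitz on every compact interval, with limsup_{η→+∞} g(η)/η < ∞ and limsup_{η→−∞} g(η)/η < ∞, and let ū(t,s) denote the unique forward solution of dū/dt = g(ū), ū(0,s) = s. Let s₀ ∈ ℝ with g(s₀) = 0, and suppose g is differentiable at s₀ with derivative g'(s₀) ∈ ℝ. Then ū(t,s₀) = s₀ for all t ≥ 0, and for every t ≥ 0 the partial derivative ∂ū/∂s(t,s₀) exists and equals e^{g'(s₀) t}. -/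
open Set Filter

noncomputable section

/-- Confinement by a fence argument. -/
theorem confine_aux (g : ℝ → ℝ) (s₀ C δ η T s : ℝ) (u : ℝ → ℝ)
    (hb : ∀ x, |x - s₀| ≤ δ → |g x| ≤ C * |x - s₀|)
    (hC : 0 ≤ C) (hη : 0 < η) (hu : IsForwardSol g s u) (hs : |s - s₀| ≤ η)
    (hδ : η * Real.exp ((C + 1) * T) ≤ δ) :
    ∀ t ∈ Icc 0 T, |u t - s₀| ≤ η * Real.exp ((C + 1) * t) := by
  obtain ⟨hu0, hu1⟩ := hu
  have hB : ∀ x : ℝ, HasDerivAt (fun t => η * Real.exp ((C + 1) * t))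
      ((C + 1) * (η * Real.exp ((C + 1) * x))) x := by
    intro x
    have h1 : HasDerivAt (fun t : ℝ => (C + 1) * t) (C + 1) x := by
      simpa using (hasDerivAt_id x).const_mul (C + 1)
    exact (h1.exp.const_mul η).congr_deriv (by ring)
  intro t ht
  have := image_norm_le_of_norm_deriv_right_lt_deriv_boundary
    (f := fun t => u t - s₀) (f' := fun t => g (u t)) (a := 0) (b := T)
    (B := fun t => η * Real.exp ((C + 1) * t))
    (B' := fun x => (C + 1) * (η * Real.exp ((C + 1) * x)))
    (fun x hx => (((hu1 x hx.1).continuousWithinAt).mono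
      (fun y hy => hy.1)).sub continuousWithinAt_const)
    (fun x hx => ((hu1 x hx.1).mono (Ici_subset_Ici.2 hx.1)).sub_const s₀)
    (by simpa [hu0] using hs) hB
    (by
      intro x hx hxe
      simp only [Real.norm_eq_abs] at hxe ⊢
      have hp : 0 < η * Real.exp ((C + 1) * x) := by positivity
      have hle : η * Real.exp ((C + 1) * x) ≤ η * Real.exp ((C + 1) * T) := by
        have := hx.2.le
        gcongr
      have := hb (u x) (by rw [hxe]; exact hle.trans hδ)
      rw [hxe] at this
      linarith) ht
  simpa using this

/-- formula (3.10) of the paper.  Let `ū(t,s)` be the unique forward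
solution of `dū/dt = g(ū)`, `ū(0,s) = s`, where `g` is continuous, one-sided Lipschitz on
every compact interval and limsup-sublinear at `±∞`.  If `g(s₀) = 0` and `g` is
differentiable at `s₀` with derivative `g'(s₀)`, then `ū(t,s₀) = s₀` for all `t ≥ 0` and
`∂ū/∂s(t,s₀)` exists and equals `e^{g'(s₀) t}`. -/
theorem characteristic_ODE_deriv_at_equilibrium
    (g : ℝ → ℝ) (hg : Continuous g) (hOSL : OSLCompact g) (hsub : SublinearLimsup g)
    (ub : ℝ → ℝ → ℝ) (hub : ∀ s : ℝ, IsForwardSol g s (fun t => ub t s))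
    (s₀ : ℝ) (hs₀ : g s₀ = 0) (g' : ℝ) (hg' : HasDerivAt g g' s₀) :
    (∀ t : ℝ, 0 ≤ t → ub t s₀ = s₀) ∧
    (∀ t : ℝ, 0 ≤ t → HasDerivAt (fun σ => ub t σ) (Real.exp (g' * t)) s₀) := by
  have hlin : ∀ ε : ℝ, 0 < ε → ∃ δ > 0, ∀ x, |x - s₀| ≤ δ →
      |g x - g' * (x - s₀)| ≤ ε * |x - s₀| := by
    intro ε hε
    have h := (hasDerivAt_iff_isLittleO.1 hg').def hε
    obtain ⟨δ, hδ, h⟩ := Metric.eventually_nhds_iff.1 h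
    refine ⟨δ / 2, by positivity, fun x hx => ?_⟩
    have := h (y := x) (by rw [Real.dist_eq]; linarith)
    simpa [hs₀, mul_comm] using this
  have hbd : ∀ ε δ : ℝ, ε ≤ 1 → (∀ x, |x - s₀| ≤ δ →
      |g x - g' * (x - s₀)| ≤ ε * |x - s₀|) →
      ∀ x, |x - s₀| ≤ δ → |g x| ≤ (|g'| + 1) * |x - s₀| := by
    intro ε δ hε h x hx
    have h1 := h x hx
    have h2 : |g x| ≤ |g x - g' * (x - s₀)| + |g' * (x - s₀)| := by
      simpa using abs_add_le (g x - g' * (x - s₀)) (g' * (x - s₀))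
    rw [abs_mul] at h2
    nlinarith [abs_nonneg (x - s₀)]
  have hC : 0 ≤ |g'| + 1 := by positivity
  have heq : ∀ t : ℝ, 0 ≤ t → ub t s₀ = s₀ := by
    intro t ht
    obtain ⟨δ, hδ, h⟩ := hlin 1 one_pos
    have hE : 0 < Real.exp ((|g'| + 1 + 1) * t) := Real.exp_pos _
    have h0 : |ub t s₀ - s₀| ≤ 0 := by
      refine le_of_forall_pos_le_add fun e he => ?_
      have := confine_aux g s₀ (|g'| + 1) δ (min e δ / Real.exp ((|g'| + 1 + 1) * t)) t s₀
        (fun t => ub t s₀) (hbd 1 δ le_rfl h) hC (by positivity) (hub s₀)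
        (by rw [sub_self, abs_zero]; positivity)
        (by rw [div_mul_cancel₀ _ hE.ne']; exact min_le_right _ _) t ⟨ht, le_rfl⟩
      rw [div_mul_cancel₀ _ hE.ne'] at this
      have h3 := min_le_left e δ
      linarith
    exact sub_eq_zero.1 (abs_nonpos_iff.1 h0)
  refine ⟨heq, fun T hT => ?_⟩
  rw [hasDerivAt_iff_isLittleO, Asymptotics.isLittleO_iff]
  intro c hc
  set M := Real.exp ((|g'| + 1 + 1) * T) with hM
  set A := Real.exp (|g'| * T) with hA
  have hMp : 0 < M := Real.exp_pos _
  have hAp : 0 < A := Real.exp_pos _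
  set D := A * (A * M * T) with hD
  have hDp : 0 ≤ D := by positivity
  set ε := min 1 (c / (D + 1)) with hε
  have hεp : 0 < ε := by positivity
  have hεD : D * ε ≤ c := by
    have h1 : ε ≤ c / (D + 1) := min_le_right _ _
    rw [le_div_iff₀ (by positivity)] at h1
    linarith
  obtain ⟨δ, hδ, h⟩ := hlin ε hεp
  rw [Metric.eventually_nhds_iff]
  refine ⟨δ / M, by positivity, fun s hs => ?_⟩
  rw [Real.dist_eq, lt_div_iff₀ hMp] at hs
  rw [heq T hT]
  by_cases hss : s = s₀
  · simp [hss, heq T hT]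
  have hη : 0 < |s - s₀| := abs_pos.2 (sub_ne_zero.2 hss)
  have hconf := confine_aux g s₀ (|g'| + 1) δ |s - s₀| T s (fun t => ub t s)
    (hbd ε δ (min_le_left _ _) h) hC hη (hub s) le_rfl hs.le
  have hconf' : ∀ t ∈ Icc 0 T, |ub t s - s₀| ≤ |s - s₀| * M := by
    intro t ht
    refine (hconf t ht).trans ?_
    have := ht.2
    rw [hM]
    gcongr
  obtain ⟨hu0, hu1⟩ := hub s
  have hexp : ∀ x : ℝ, HasDerivAt (fun t : ℝ => Real.exp (-(g' * t)))
      (Real.exp (-(g' * x)) * (-g')) x := by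
    intro x
    have h1 : HasDerivAt (fun t : ℝ => -(g' * t)) (-g') x := by
      have h2 : HasDerivAt (fun t : ℝ => g' * t) g' x := by
        simpa using (hasDerivAt_id x).const_mul g'
      exact h2.neg
    exact h1.exp
  have hw : ∀ x ∈ Icc 0 T, HasDerivWithinAt
      (fun t => Real.exp (-(g' * t)) * (ub t s - s₀))
      (Real.exp (-(g' * x)) * (g (ub x s) - g' * (ub x s - s₀))) (Icc 0 T) x := by
    intro x hx
    have h1 := (hexp x).hasDerivWithinAt (s := Icc 0 T)
    have h2 := ((hu1 x hx.1).mono (fun y (hy : y ∈ Icc 0 T) => hy.1)).sub_const s₀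
    refine (h1.mul h2).congr_deriv ?_
    ring
  have hwb : ∀ x ∈ Icc 0 T,
      ‖Real.exp (-(g' * x)) * (g (ub x s) - g' * (ub x s - s₀))‖ ≤
        A * (ε * (|s - s₀| * M)) := by
    intro x hx
    have hx1 := hconf' x hx
    rw [norm_mul, Real.norm_eq_abs, Real.norm_eq_abs, abs_of_pos (Real.exp_pos _)]
    have h1 : Real.exp (-(g' * x)) ≤ A := by
      rw [hA]
      apply Real.exp_le_exp.2
      nlinarith [neg_abs_le g', abs_nonneg g', hx.1, hx.2]
    have h2 : |g (ub x s) - g' * (ub x s - s₀)| ≤ ε * (|s - s₀| * M) :=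
      (h _ (hx1.trans hs.le)).trans (by gcongr)
    gcongr
  have hmv := (convex_Icc 0 T).norm_image_sub_le_of_norm_hasDerivWithin_le hw hwb
    (left_mem_Icc.2 hT) (right_mem_Icc.2 hT)
  simp only [hu0, Real.norm_eq_abs, sub_zero, abs_of_nonneg hT, mul_zero, neg_zero,
    Real.exp_zero, one_mul] at hmv
  have hid : ub T s - s₀ - (s - s₀) * Real.exp (g' * T) =
      Real.exp (g' * T) * (Real.exp (-(g' * T)) * (ub T s - s₀) - (s - s₀)) := by
    have : Real.exp (g' * T) * Real.exp (-(g' * T)) = 1 := by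
      rw [← Real.exp_add]; simp
    linear_combination (-(ub T s - s₀)) * this
  rw [smul_eq_mul, hid, norm_mul, Real.norm_eq_abs, Real.norm_eq_abs, Real.norm_eq_abs,
    abs_of_pos (Real.exp_pos _)]
  have h1 : Real.exp (g' * T) ≤ A := by
    rw [hA]
    apply Real.exp_le_exp.2
    nlinarith [le_abs_self g']
  calc _ ≤ A * (A * (ε * (|s - s₀| * M)) * T) := by gcongr
    _ = (D * ε) * |s - s₀| := by rw [hD]; ring
    _ ≤ c * |s - s₀| := by gcongr
end
end

section
/- Consider the Riemann setup: f_i ∈ C²(ℝ) for i = 1,…,n; g : ℝ → ℝ continuous, one-sided Lipschitz on every compact interval, with limsup_{η→±∞} g(η)/η < ∞; ū(t,s) the unique forward solution of dū/dt = g(ū), ū(0,s) = s; χ_i(t,s) := ∫₀^t f_i'(ū(τ,s)) dτ and χ(t,s) := (χ₁(t,s),…,χₙ(t,s)); M ∈ C¹(ℝⁿ); u₋, u₊ ∈ ℝ; and Condition (H): for every x ∈ ℝⁿ with M(x) = 0 and every u ∈ (a,b), Σ_{i=1}^n ∂M/∂x_i(x) f_i''(u) > 0, where a ≤ inf_{t≥0}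 min{ū(t,u₋), ū(t,u₊)} and b ≥ sup_{t≥0} max{ū(t,u₋), ū(t,u₊)}. Fix (t,x) with t > 0 and define Q(s) := M(x − χ(t,s)) for s between u₋ and u₊. If s₀ lies strictly between min{u₋,u₊} and max{u₋,u₊} (inclusive of endpoints) and Q(s₀) = 0, then there exists δ > 0 such that for every s lying between u₋ and u₊ with 0 < |s − s₀| < δ, one has (s − s₀) Q(s) < 0. -/
open Set Filter MeasureTheory

noncomputable section

/-- Euclidean space `ℝⁿ`. -/
abbrev Euc (n : ℕ) := EuclideanSpace ℝ (Fin n)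

/-- OSL estimate for two solutions. -/
lemma osl_est {g u v : ℝ → ℝ} {T α β L : ℝ}
    (hL : ∀ w ∈ Set.Icc α β, ∀ z ∈ Set.Icc α β, w ≠ z → (g w - g z) / (w - z) ≤ L)
    (hu : ∀ t ∈ Set.Ici (0:ℝ), HasDerivWithinAt u (g (u t)) (Set.Ici 0) t)
    (hv : ∀ t ∈ Set.Ici (0:ℝ), HasDerivWithinAt v (g (v t)) (Set.Ici 0) t)
    (hu' : ∀ t ∈ Set.Icc 0 T, u t ∈ Set.Icc α β)
    (hv' : ∀ t ∈ Set.Icc 0 T, v t ∈ Set.Icc α β)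
    {r s : ℝ} (hr : 0 ≤ r) (hrs : r ≤ s) (hs : s ≤ T) :
    |u s - v s| ≤ Real.exp (L * (s - r)) * |u r - v r| := by
  have hanti : AntitoneOn (fun τ => Real.exp (-(2 * L) * τ) * (u τ - v τ) ^ 2) (Set.Icc 0 T) := by
    have huc : ContinuousOn u (Set.Icc 0 T) := fun τ hτ =>
      ((hu τ hτ.1).continuousWithinAt).mono (fun y hy => hy.1)
    have hvc : ContinuousOn v (Set.Icc 0 T) := fun τ hτ =>
      ((hv τ hτ.1).continuousWithinAt).mono (fun y hy => hy.1)
    have hder : ∀ τ ∈ interior (Set.Icc 0 T), HasDerivAt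
        (fun τ => Real.exp (-(2 * L) * τ) * (u τ - v τ) ^ 2)
        (Real.exp (-(2 * L) * τ) * (-(2 * L)) * (u τ - v τ) ^ 2 +
          Real.exp (-(2 * L) * τ) * (2 * (u τ - v τ) * (g (u τ) - g (v τ)))) τ := by
      intro τ hτ
      rw [interior_Icc] at hτ
      have h1 := (hu τ hτ.1.le).hasDerivAt (Ici_mem_nhds hτ.1)
      have h2 := (hv τ hτ.1.le).hasDerivAt (Ici_mem_nhds hτ.1)
      have h3 : HasDerivAt (fun τ => Real.exp (-(2 * L) * τ))
          (Real.exp (-(2 * L) * τ) * (-(2 * L))) τ := by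
        have := ((hasDerivAt_id τ).const_mul (-(2 * L))).exp
        simpa using this
      have h4 := h3.mul ((h1.sub h2).pow 2)
      refine HasDerivAt.congr_deriv h4 ?_
      norm_num
    apply antitoneOn_of_deriv_nonpos (convex_Icc 0 T)
    · fun_prop
    · intro τ hτ
      exact (hder τ hτ).differentiableAt.differentiableWithinAt
    · intro τ hτ
      rw [(hder τ hτ).deriv]
      have hτ' : τ ∈ Set.Icc 0 T := interior_subset hτ
      have key : (u τ - v τ) * (g (u τ) - g (v τ)) ≤ L * (u τ - v τ) ^ 2 := by
        by_cases h : u τ = v τ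
        · simp [h]
        · have h5 := hL _ (hu' τ hτ') _ (hv' τ hτ') h
          have h6 : u τ - v τ ≠ 0 := sub_ne_zero.mpr h
          have h7 : (u τ - v τ) * (g (u τ) - g (v τ)) =
              (g (u τ) - g (v τ)) / (u τ - v τ) * (u τ - v τ) ^ 2 := by
            field_simp
          rw [h7]
          exact mul_le_mul_of_nonneg_right h5 (sq_nonneg _)
      have hp := Real.exp_pos (-(2 * L) * τ)
      nlinarith
  have h := hanti ⟨hr, hrs.trans hs⟩ ⟨hr.trans hrs, hs⟩ hrs
  simp only at h
  apply abs_le_of_sq_le_sq' _ (by positivity) |> abs_le.mpr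
  rw [mul_pow, sq_abs, ← Real.exp_nat_mul]
  have h8 := mul_le_mul_of_nonneg_left h (Real.exp_pos (2 * L * s)).le
  rw [← mul_assoc, ← mul_assoc, ← Real.exp_add, ← Real.exp_add] at h8
  have e1 : 2 * L * s + -(2 * L) * s = 0 := by ring
  have e2 : 2 * L * s + -(2 * L) * r = (2:ℕ) * (L * (s - r)) := by push_cast; ring
  rw [e1, e2, Real.exp_zero, one_mul] at h8
  exact h8

lemma sol_mono {g u v : ℝ → ℝ} (hOSL : OSLCompact g)
    (hu : ∀ t ∈ Set.Ici (0:ℝ), HasDerivWithinAt u (g (u t)) (Set.Ici 0) t)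
    (hv : ∀ t ∈ Set.Ici (0:ℝ), HasDerivWithinAt v (g (v t)) (Set.Ici 0) t)
    (h0 : u 0 ≤ v 0) {T : ℝ} (hT : 0 ≤ T) : u T ≤ v T := by
  have huc : ContinuousOn u (Set.Icc 0 T) := fun τ hτ =>
    ((hu τ hτ.1).continuousWithinAt).mono (fun y hy => hy.1)
  have hvc : ContinuousOn v (Set.Icc 0 T) := fun τ hτ =>
    ((hv τ hτ.1).continuousWithinAt).mono (fun y hy => hy.1)
  obtain ⟨A, hA⟩ := isCompact_Icc.exists_bound_of_continuousOn huc
  obtain ⟨B, hB⟩ := isCompact_Icc.exists_bound_of_continuousOn hvc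
  have hA0 : 0 ≤ A := (norm_nonneg _).trans (hA 0 ⟨le_rfl, hT⟩)
  have hB0 : 0 ≤ B := (norm_nonneg _).trans (hB 0 ⟨le_rfl, hT⟩)
  obtain ⟨L, hL⟩ := hOSL (-(A + B + 1)) (A + B + 1) (by linarith)
  by_contra! hlt
  obtain ⟨r, hr, hr0⟩ : (0:ℝ) ∈ (fun τ => u τ - v τ) '' Set.Icc 0 T :=
    intermediate_value_Icc hT (huc.sub hvc) ⟨sub_nonpos.mpr h0, sub_nonneg.mpr hlt.le⟩
  have := osl_est (T := T) hL hu hv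
    (fun τ hτ => by have := abs_le.mp (hA τ hτ); constructor <;> linarith)
    (fun τ hτ => by have := abs_le.mp (hB τ hτ); constructor <;> linarith) hr.1 hr.2 le_rfl
  simp only at hr0
  rw [hr0, abs_zero, mul_zero] at this
  have := abs_le.mp this
  linarith

/-- Strict down-crossings: at most one zero. -/
lemma cross_right {q : ℝ → ℝ} {m₁ m₂ : ℝ} (hq : ContinuousOn q (Set.Icc m₁ m₂))
    (hc : ∀ r ∈ Set.Ioo m₁ m₂, q r = 0 → ∃ δ > 0, ∀ s ∈ Set.Icc m₁ m₂,
      0 < |s - r| → |s - r| < δ → (s - r) * q s < 0)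
    {σ s : ℝ} (hσ : σ ∈ Set.Ioo m₁ m₂) (hs : s ∈ Set.Ioo m₁ m₂) (hσs : σ < s) (h0 : q σ = 0) :
    q s < 0 := by
  by_contra! hcon
  obtain ⟨δ, hδ, h⟩ := hc σ hσ h0
  obtain ⟨σ', h1, h2⟩ := exists_between (lt_min (lt_add_of_pos_right σ hδ) hσs)
  rw [lt_min_iff] at h2
  have hneg : q σ' < 0 := by
    have e : |σ' - σ| = σ' - σ := abs_of_pos (by linarith)
    have := h σ' ⟨by linarith [hσ.1], by linarith [hs.2]⟩ (by rw [e]; linarith)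
      (by rw [e]; linarith)
    by_contra! h'
    nlinarith
  have hsub : Set.Icc σ' s ⊆ Set.Icc m₁ m₂ :=
    Set.Icc_subset_Icc (by linarith [hσ.1]) (by linarith [hs.2])
  have hqc := hq.mono hsub
  have hcl : IsClosed (Set.Icc σ' s ∩ q ⁻¹' Set.Ici 0) :=
    hqc.preimage_isClosed_of_isClosed isClosed_Icc isClosed_Ici
  have hcomp : IsCompact (Set.Icc σ' s ∩ q ⁻¹' Set.Ici 0) :=
    isCompact_Icc.of_isClosed_subset hcl Set.inter_subset_left
  obtain ⟨r, hr, hmin⟩ := hcomp.exists_isLeast ⟨s, ⟨h2.2.le, le_rfl⟩, hcon⟩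
  have hr0 : (0:ℝ) ≤ q r := hr.2
  have hσr : σ' < r := by
    rcases hr.1.1.lt_or_eq with h | h
    · exact h
    · rw [← h] at hr0; linarith
  have hbelow : ∀ y, σ' ≤ y → y < r → q y < 0 := by
    intro y hy1 hy2
    by_contra! h'
    exact absurd (hmin ⟨⟨hy1, hy2.le.trans hr.1.2⟩, h'⟩) (not_le.mpr hy2)
  have hrz : q r = 0 := by
    refine le_antisymm ?_ hr0
    by_contra! hpos
    obtain ⟨y, hy, hy0⟩ : (0:ℝ) ∈ q '' Set.Icc σ' r :=
      intermediate_value_Icc hσr.le (hqc.mono (Set.Icc_subset_Icc le_rfl hr.1.2))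
        ⟨hneg.le, hpos.le⟩
    rcases hy.2.lt_or_eq with h' | h'
    · exact absurd hy0 (hbelow y hy.1 h').ne
    · rw [h'] at hy0; linarith
  obtain ⟨δ', hδ', h'⟩ := hc r ⟨by linarith [hσ.1], by linarith [hs.2, hr.1.2]⟩ hrz
  obtain ⟨y, hy1, hy2⟩ := exists_between (max_lt (sub_lt_self r hδ') hσr)
  rw [max_lt_iff] at hy1
  have e : |y - r| = r - y := by rw [abs_of_neg (by linarith)]; ring
  have := h' y (hsub ⟨hy1.2.le, hy2.le.trans hr.1.2⟩) (by rw [e]; linarith) (by rw [e]; linarith)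
  have := hbelow y hy1.2.le hy2
  nlinarith

lemma cross_left {q : ℝ → ℝ} {m₁ m₂ : ℝ} (hq : ContinuousOn q (Set.Icc m₁ m₂))
    (hc : ∀ r ∈ Set.Ioo m₁ m₂, q r = 0 → ∃ δ > 0, ∀ s ∈ Set.Icc m₁ m₂,
      0 < |s - r| → |s - r| < δ → (s - r) * q s < 0)
    {σ s : ℝ} (hσ : σ ∈ Set.Ioo m₁ m₂) (hs : s ∈ Set.Ioo m₁ m₂) (hσs : s < σ) (h0 : q σ = 0) :
    0 < q s := by
  have := cross_right (q := fun r => - q (-r)) (m₁ := -m₂) (m₂ := -m₁) (σ := -σ) (s := -s)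
    (by
      apply ContinuousOn.neg
      refine hq.comp continuousOn_neg ?_
      intro y hy
      exact ⟨by linarith [hy.2], by linarith [hy.1]⟩)
    (by
      intro r hr hr0
      obtain ⟨δ, hδ, h⟩ := hc (-r) ⟨by linarith [hr.2], by linarith [hr.1]⟩ (by simpa using hr0)
      refine ⟨δ, hδ, fun s hs h1 h2 => ?_⟩
      have e : |(-s) - (-r)| = |s - r| := by rw [← abs_neg]; congr 1; ring
      have := h (-s) ⟨by linarith [hs.2], by linarith [hs.1]⟩ (by rwa [e]) (by rwa [e])
      linarith)
    ⟨by linarith [hσ.2], by linarith [hσ.1]⟩ ⟨by linarith [hs.2], by linarith [hs.1]⟩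
    (by linarith) (by simpa using h0)
  simpa using this

lemma int_ratio {d : ℝ → ℝ} {t τ₀ E : ℝ} (h0 : 0 < τ₀) (h1 : τ₀ ≤ t) (hE : 0 ≤ E)
    (hdc : ContinuousOn d (Set.Icc 0 t)) (hd0 : ∀ τ ∈ Set.Icc 0 t, 0 ≤ d τ)
    (hd : ∀ r s, 0 ≤ r → r ≤ s → s ≤ t → d s ≤ E * d r) :
    ∫ τ in (0:ℝ)..t, d τ ≤ (1 + E ^ 2 * t / τ₀) * ∫ τ in (0:ℝ)..τ₀, d τ := by
  have hi1 : IntervalIntegrable d volume 0 τ₀ :=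
    (hdc.mono (Set.Icc_subset_Icc le_rfl h1)).intervalIntegrable_of_Icc h0.le
  have hi2 : IntervalIntegrable d volume τ₀ t :=
    (hdc.mono (Set.Icc_subset_Icc h0.le le_rfl)).intervalIntegrable_of_Icc h1
  rw [← intervalIntegral.integral_add_adjacent_intervals hi1 hi2]
  have hA : ∫ τ in τ₀..t, d τ ≤ (t - τ₀) * (E * d τ₀) := by
    have := intervalIntegral.integral_mono_on h1 hi2
      (intervalIntegrable_const (c := E * d τ₀)) (fun s hs => hd τ₀ s h0.le hs.1 hs.2)
    rwa [intervalIntegral.integral_const, smul_eq_mul] at this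
  have hB : τ₀ * d τ₀ ≤ E * ∫ τ in (0:ℝ)..τ₀, d τ := by
    have := intervalIntegral.integral_mono_on h0.le
      (intervalIntegrable_const (c := d τ₀)) (hi1.const_mul E)
      (fun s hs => hd s τ₀ hs.1 hs.2 h1)
    simpa using this
  have hdτ : 0 ≤ d τ₀ := hd0 τ₀ ⟨h0.le, h1⟩
  have hC : (t - τ₀) * (E * d τ₀) ≤ E ^ 2 * t / τ₀ * ∫ τ in (0:ℝ)..τ₀, d τ := by
    have ht : 0 ≤ t := h0.le.trans h1
    calc (t - τ₀) * (E * d τ₀) ≤ t * (E * d τ₀) := by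
          apply mul_le_mul_of_nonneg_right (by linarith) (by positivity)
      _ = E * t / τ₀ * (τ₀ * d τ₀) := by field_simp
      _ ≤ E * t / τ₀ * (E * ∫ τ in (0:ℝ)..τ₀, d τ) := by
          apply mul_le_mul_of_nonneg_left hB (by positivity)
      _ = _ := by ring
  linarith

lemma int_lip {φ u v : ℝ → ℝ} {t a b K : ℝ} (ht : 0 ≤ t) (hφ : Continuous φ)
    (huc : ContinuousOn u (Set.Icc 0 t)) (hvc : ContinuousOn v (Set.Icc 0 t))
    (hu : ∀ τ ∈ Set.Icc 0 t, u τ ∈ Set.Icc a b) (hv : ∀ τ ∈ Set.Icc 0 t, v τ ∈ Set.Icc a b)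
    (hle : ∀ τ ∈ Set.Icc 0 t, u τ ≤ v τ)
    (hK : ∀ w ∈ Set.Icc a b, ∀ z ∈ Set.Icc a b, |φ w - φ z| ≤ K * |w - z|) :
    |(∫ τ in (0:ℝ)..t, φ (v τ)) - ∫ τ in (0:ℝ)..t, φ (u τ)| ≤
      K * ∫ τ in (0:ℝ)..t, (v τ - u τ) := by
  have hi1 : IntervalIntegrable (fun τ => φ (u τ)) volume 0 t :=
    (hφ.comp_continuousOn huc).intervalIntegrable_of_Icc ht
  have hi2 : IntervalIntegrable (fun τ => φ (v τ)) volume 0 t :=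
    (hφ.comp_continuousOn hvc).intervalIntegrable_of_Icc ht
  have hi3 : IntervalIntegrable (fun τ => v τ - u τ) volume 0 t :=
    (hvc.sub huc).intervalIntegrable_of_Icc ht
  rw [← intervalIntegral.integral_sub hi2 hi1, ← intervalIntegral.integral_const_mul]
  refine (intervalIntegral.abs_integral_le_integral_abs ht).trans ?_
  apply intervalIntegral.integral_mono_on ht (hi2.sub hi1).abs (hi3.const_mul K)
  intro τ hτ
  refine (hK _ (hv τ hτ) _ (hu τ hτ)).trans_eq ?_
  rw [abs_of_nonneg (by linarith [hle τ hτ])]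

lemma int_lower {φ u v : ℝ → ℝ} {t τ₀ a b a' b' c : ℝ} (h0 : 0 < τ₀) (h1 : τ₀ ≤ t)
    (hφ : Continuous φ)
    (huc : ContinuousOn u (Set.Icc 0 t)) (hvc : ContinuousOn v (Set.Icc 0 t))
    (hu : ∀ τ ∈ Set.Icc 0 t, u τ ∈ Set.Icc a b) (hv : ∀ τ ∈ Set.Icc 0 t, v τ ∈ Set.Icc a b)
    (hle : ∀ τ ∈ Set.Icc 0 t, u τ ≤ v τ)
    (hmono : MonotoneOn φ (Set.Icc a b))
    (hu' : ∀ τ ∈ Set.Icc 0 τ₀, u τ ∈ Set.Icc a' b')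
    (hv' : ∀ τ ∈ Set.Icc 0 τ₀, v τ ∈ Set.Icc a' b')
    (hc : ∀ w ∈ Set.Icc a' b', ∀ z ∈ Set.Icc a' b', w ≤ z → c * (z - w) ≤ φ z - φ w) :
    c * (∫ τ in (0:ℝ)..τ₀, (v τ - u τ)) ≤
    (∫ τ in (0:ℝ)..t, φ (v τ)) - ∫ τ in (0:ℝ)..t, φ (u τ) := by
  have ht : 0 ≤ t := h0.le.trans h1
  have hc1 := hφ.comp_continuousOn huc
  have hc2 := hφ.comp_continuousOn hvc
  have hcd : ContinuousOn (fun τ => φ (v τ) - φ (u τ)) (Set.Icc 0 t) := hc2.sub hc1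
  have hi1 : IntervalIntegrable (fun τ => φ (u τ)) volume 0 t := hc1.intervalIntegrable_of_Icc ht
  have hi2 : IntervalIntegrable (fun τ => φ (v τ)) volume 0 t := hc2.intervalIntegrable_of_Icc ht
  have hs1 : Set.Icc 0 τ₀ ⊆ Set.Icc 0 t := Set.Icc_subset_Icc le_rfl h1
  have hi3 : IntervalIntegrable (fun τ => v τ - u τ) volume 0 τ₀ :=
    ((hvc.sub huc).mono hs1).intervalIntegrable_of_Icc h0.le
  have hj1 : IntervalIntegrable (fun τ => φ (v τ) - φ (u τ)) volume 0 τ₀ :=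
    (hcd.mono hs1).intervalIntegrable_of_Icc h0.le
  have hj2 : IntervalIntegrable (fun τ => φ (v τ) - φ (u τ)) volume τ₀ t :=
    (hcd.mono (Set.Icc_subset_Icc h0.le le_rfl)).intervalIntegrable_of_Icc h1
  rw [← intervalIntegral.integral_sub hi2 hi1, ← intervalIntegral.integral_const_mul,
    ← intervalIntegral.integral_add_adjacent_intervals hj1 hj2]
  have hA : 0 ≤ ∫ τ in τ₀..t, (φ (v τ) - φ (u τ)) := by
    apply intervalIntegral.integral_nonneg h1
    intro τ hτ
    have hτ' : τ ∈ Set.Icc 0 t := ⟨h0.le.trans hτ.1, hτ.2⟩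
    exact sub_nonneg.mpr (hmono (hu τ hτ') (hv τ hτ') (hle τ hτ'))
  have hB : ∫ τ in (0:ℝ)..τ₀, c * (v τ - u τ) ≤ ∫ τ in (0:ℝ)..τ₀, (φ (v τ) - φ (u τ)) := by
    apply intervalIntegral.integral_mono_on h0.le (hi3.const_mul c) hj1
    intro τ hτ
    exact hc _ (hu' τ hτ) _ (hv' τ hτ) (hle τ (hs1 hτ))
  linarith

lemma clm_apply_sum {n : ℕ} (A : Euc n →L[ℝ] ℝ) (h : Euc n) :
    A h = ∑ i, A (EuclideanSpace.single i 1) * h i := by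
  conv_lhs => rw [← (EuclideanSpace.basisFun (Fin n) ℝ).sum_repr h]
  rw [map_sum]
  refine Finset.sum_congr rfl fun i _ => ?_
  simp [mul_comm]

lemma euc_norm_le {n : ℕ} (h : Euc n) : ‖h‖ ≤ ∑ i, |h i| := by
  conv_lhs => rw [← (EuclideanSpace.basisFun (Fin n) ℝ).sum_repr h]
  refine (norm_sum_le _ _).trans ?_
  refine Finset.sum_le_sum fun i _ => ?_
  simp [norm_smul]

/-- Lipschitz constant for the derivative of a `C²` function on a compact interval. -/
lemma deriv_lip {f : ℝ → ℝ} (hf : ContDiff ℝ 2 f) (a b : ℝ) :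
    ∃ K, 0 ≤ K ∧ ∀ w ∈ Set.Icc a b, ∀ z ∈ Set.Icc a b,
      |deriv f w - deriv f z| ≤ K * |w - z| := by
  have h1 : ContDiff ℝ 1 (deriv f) := by
    have : ContDiff ℝ (1 + 1) f := by simpa [one_add_one_eq_two] using hf
    exact (contDiff_succ_iff_deriv.mp this).2.2
  have h2 : Continuous (deriv (deriv f)) := h1.continuous_deriv le_rfl
  obtain ⟨K, hK⟩ := (isCompact_Icc (a := a) (b := b)).exists_bound_of_continuousOn h2.continuousOn
  refine ⟨max K 0, le_max_right _ _, fun w hw z hz => ?_⟩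
  have := (convex_Icc a b).norm_image_sub_le_of_norm_deriv_le (f := deriv f)
    (fun y _ => (h1.differentiable one_ne_zero) y)
    (fun y hy => (hK y hy).trans (le_max_left _ 0)) hz hw
  simpa using this

/-- The data of the monotone flow used in the crossing argument. -/
structure FlowData (U : ℝ → ℝ → ℝ) (m₁ m₂ a b E t : ℝ) : Prop where
  ht : 0 < t
  hE : 0 ≤ E
  start : ∀ s, U 0 s = s
  cont : ∀ s, ContinuousOn (fun τ => U τ s) (Set.Icc 0 t)
  mem : ∀ s ∈ Set.Icc m₁ m₂, ∀ τ ∈ Set.Icc 0 t, U τ s ∈ Set.Icc a b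
  mono : ∀ s s', s ≤ s' → ∀ τ ∈ Set.Icc 0 t, U τ s ≤ U τ s'
  est : ∀ s ∈ Set.Icc m₁ m₂, ∀ s' ∈ Set.Icc m₁ m₂, ∀ r τ, 0 ≤ r → r ≤ τ → τ ≤ t →
    |U τ s' - U τ s| ≤ E * |U r s' - U r s|

lemma chi_lip {n : ℕ} {f : Fin n → ℝ → ℝ} (hf : ∀ i, ContDiff ℝ 2 (f i))
    {U : ℝ → ℝ → ℝ} {m₁ m₂ a b E t : ℝ} (F : FlowData U m₁ m₂ a b E t)
    {X : ℝ → Euc n} (hX : ∀ s i, X s i = ∫ τ in (0:ℝ)..t, deriv (f i) (U τ s)) :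
    ∃ K, 0 ≤ K ∧ ∀ s ∈ Set.Icc m₁ m₂, ∀ s' ∈ Set.Icc m₁ m₂, s ≤ s' →
      ‖X s' - X s‖ ≤ K * ∫ τ in (0:ℝ)..t, (U τ s' - U τ s) := by
  choose K hK0 hK using fun i => deriv_lip (hf i) a b
  refine ⟨∑ i, K i, Finset.sum_nonneg fun i _ => hK0 i, fun s hs s' hs' hss => ?_⟩
  refine (euc_norm_le _).trans ?_
  rw [Finset.sum_mul]
  refine Finset.sum_le_sum fun i _ => ?_
  rw [PiLp.sub_apply, hX, hX]
  exact int_lip F.ht.le ((hf i).continuous_deriv (by norm_num)) (F.cont s) (F.cont s')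
    (F.mem s hs) (F.mem s' hs') (F.mono s s' hss) (hK i)

lemma chi_lip' {n : ℕ} {f : Fin n → ℝ → ℝ} (hf : ∀ i, ContDiff ℝ 2 (f i))
    {U : ℝ → ℝ → ℝ} {m₁ m₂ a b E t : ℝ} (F : FlowData U m₁ m₂ a b E t)
    {X : ℝ → Euc n} (hX : ∀ s i, X s i = ∫ τ in (0:ℝ)..t, deriv (f i) (U τ s)) :
    ∃ K, 0 ≤ K ∧ ∀ s ∈ Set.Icc m₁ m₂, ∀ s' ∈ Set.Icc m₁ m₂, 
      ‖X s' - X s‖ ≤ K * |s' - s| := by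
  obtain ⟨K, hK0, hK⟩ := chi_lip hf F hX
  have key : ∀ s ∈ Set.Icc m₁ m₂, ∀ s' ∈ Set.Icc m₁ m₂, s ≤ s' →
      ‖X s' - X s‖ ≤ (K * (t * E)) * |s' - s| := by
    intro s hs s' hs' hss
    refine (hK s hs s' hs' hss).trans ?_
    rw [mul_assoc]
    refine mul_le_mul_of_nonneg_left ?_ hK0
    have := intervalIntegral.integral_mono_on F.ht.le
      (((F.cont s').sub (F.cont s)).intervalIntegrable_of_Icc (μ := volume) F.ht.le)
      (intervalIntegrable_const (c := E * |s' - s|)) (fun τ hτ => by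
        have h := F.est s hs s' hs' 0 τ le_rfl hτ.1 hτ.2
        rw [F.start, F.start] at h
        exact (le_abs_self _).trans h)
    rw [intervalIntegral.integral_const, smul_eq_mul, sub_zero, ← mul_assoc] at this
    exact this
  refine ⟨K * (t * E), mul_nonneg hK0 (mul_nonneg F.ht.le F.hE), fun s hs s' hs' => ?_⟩
  rcases le_total s s' with h | h
  · exact key s hs s' hs' h
  · rw [norm_sub_rev, abs_sub_comm]
    exact key s' hs' s hs h

lemma local_cross {n : ℕ} {f : Fin n → ℝ → ℝ} (hf : ∀ i, ContDiff ℝ 2 (f i))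
    {U : ℝ → ℝ → ℝ} {m₁ m₂ a b E t : ℝ} (F : FlowData U m₁ m₂ a b E t)
    (ha : a ≤ m₁) (hb : m₂ ≤ b)
    {X : ℝ → Euc n} (hX : ∀ s i, X s i = ∫ τ in (0:ℝ)..t, deriv (f i) (U τ s))
    {M : Euc n → ℝ} (hM : ContDiff ℝ 1 M)
    (hH : ∀ x : Euc n, M x = 0 → ∀ w ∈ Set.Ioo a b,
      0 < ∑ i, fderiv ℝ M x (EuclideanSpace.single i 1) * deriv (deriv (f i)) w)
    (z : Euc n) (r : ℝ) (hr : r ∈ Set.Ioo m₁ m₂) (hz : M (z - X r) = 0) :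
    ∃ δ > 0, ∀ s ∈ Set.Icc m₁ m₂,
      0 < |s - r| → |s - r| < δ → (s - r) * M (z - X s) < 0 := by
  have hrI : r ∈ Set.Icc m₁ m₂ := ⟨hr.1.le, hr.2.le⟩
  have ht := F.ht
  have hE := F.hE
  set y₀ := z - X r with hy₀
  set A := fderiv ℝ M y₀ with hA
  have hf1 : ∀ i, ContDiff ℝ 1 (deriv (f i)) := fun i => by
    have : ContDiff ℝ (1 + 1) (f i) := by simpa [one_add_one_eq_two] using hf i
    exact (contDiff_succ_iff_deriv.mp this).2.2
  have hf2 : ∀ i, Continuous (deriv (deriv (f i))) := fun i => (hf1 i).continuous_deriv le_rfl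
  -- the scalar function φ
  let φ : ℝ → ℝ := fun w => ∑ i, A (EuclideanSpace.single i 1) * deriv (f i) w
  let ψ : ℝ → ℝ := fun w => ∑ i, A (EuclideanSpace.single i 1) * deriv (deriv (f i)) w
  have hφd : ∀ w, HasDerivAt φ (ψ w) w := by
    intro w
    apply HasDerivAt.fun_sum
    intro i _
    exact (((hf1 i).differentiable one_ne_zero) w).hasDerivAt.const_mul _
  have hφdiff : Differentiable ℝ φ := fun w => (hφd w).differentiableAt
  have hφc : Continuous φ := hφdiff.continuous
  have hψc : Continuous ψ := by
    apply continuous_finsetSum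
    intro i _
    exact continuous_const.mul (hf2 i)
  have hψpos : ∀ w ∈ Set.Ioo a b, 0 < ψ w := hH y₀ hz
  have hmono : MonotoneOn φ (Set.Icc a b) := by
    apply monotoneOn_of_deriv_nonneg (convex_Icc a b) hφc.continuousOn hφdiff.differentiableOn
    intro w hw
    rw [interior_Icc] at hw
    rw [(hφd w).deriv]
    exact (hψpos w hw).le
  -- compact subinterval
  obtain ⟨ρ, hρ0, hρ1⟩ := exists_between (lt_min (sub_pos.mpr hr.1) (sub_pos.mpr hr.2))
  rw [lt_min_iff] at hρ1
  have hsubab : Set.Icc (r - ρ) (r + ρ) ⊆ Set.Ioo a b := fun w hw =>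
    ⟨by linarith [hw.1], by linarith [hw.2]⟩
  obtain ⟨w₀, hw₀, hmin⟩ := (isCompact_Icc (a := r - ρ) (b := r + ρ)).exists_isMinOn
    ⟨r, by linarith, by linarith⟩ hψc.continuousOn
  set c := ψ w₀ with hc
  have hc0 : 0 < c := hψpos w₀ (hsubab hw₀)
  have hlow : ∀ w ∈ Set.Icc (r - ρ) (r + ρ), ∀ z ∈ Set.Icc (r - ρ) (r + ρ), w ≤ z →
      c * (z - w) ≤ φ z - φ w := by
    intro w hw z hz hwz
    refine (convex_Icc (r - ρ) (r + ρ)).mul_sub_le_image_sub_of_le_deriv hφc.continuousOn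
      hφdiff.differentiableOn ?_ w hw z hz hwz
    intro y hy
    rw [(hφd y).deriv]
    exact hmin (interior_subset hy)
  -- small time
  obtain ⟨τ₀, hτ0, hτt, hτ⟩ : ∃ τ₀, 0 < τ₀ ∧ τ₀ ≤ t ∧ ∀ τ ∈ Set.Icc 0 τ₀, |U τ r - r| ≤ ρ / 2 := by
    have h1 := (F.cont r) 0 ⟨le_rfl, ht.le⟩
    obtain ⟨η, hη, h2⟩ := Metric.continuousWithinAt_iff.mp h1 (ρ / 2) (by linarith)
    refine ⟨min (η / 2) t, lt_min (by linarith) ht, min_le_right _ _, fun τ hτ => ?_⟩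
    have h3 := h2 (x := τ) ⟨hτ.1, hτ.2.trans (min_le_right _ _)⟩ (by
      rw [Real.dist_eq, sub_zero, abs_of_nonneg hτ.1]
      have := hτ.2.trans (min_le_left _ _)
      linarith)
    rw [F.start, Real.dist_eq] at h3
    exact h3.le
  obtain ⟨K, hK0, hK⟩ := chi_lip hf F hX
  obtain ⟨K', hK'0, hK'⟩ := chi_lip' hf F hX
  set C := K * (1 + E ^ 2 * t / τ₀) with hC
  have hC0 : 0 ≤ C := by positivity
  -- bounds for pairs
  have pair : ∀ s ∈ Set.Icc m₁ m₂, ∀ s' ∈ Set.Icc m₁ m₂, s < s' →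
      E * |s - r| ≤ ρ / 2 → E * |s' - r| ≤ ρ / 2 →
      ∃ I, 0 < I ∧ ‖X s' - X s‖ ≤ C * I ∧ c * I ≤ A (X s' - X s) := by
    intro s hs s' hs' hss hsr hsr'
    have near : ∀ s ∈ Set.Icc m₁ m₂, E * |s - r| ≤ ρ / 2 → ∀ τ ∈ Set.Icc 0 τ₀,
        U τ s ∈ Set.Icc (r - ρ) (r + ρ) := by
      intro s hs hsr τ hτ'
      have h1 := F.est r hrI s hs 0 τ le_rfl hτ'.1 (hτ'.2.trans hτt)
      rw [F.start, F.start] at h1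
      have h2 := abs_le.mp (h1.trans hsr)
      have h3 := abs_le.mp (hτ τ hτ')
      constructor <;> linarith
    have hdc : ContinuousOn (fun τ => U τ s' - U τ s) (Set.Icc 0 t) := (F.cont s').sub (F.cont s)
    have hd0 : ∀ τ ∈ Set.Icc 0 t, 0 ≤ U τ s' - U τ s := fun τ hτ =>
      sub_nonneg.mpr (F.mono s s' hss.le τ hτ)
    refine ⟨∫ τ in (0:ℝ)..τ₀, (U τ s' - U τ s), ?_, ?_, ?_⟩
    · apply intervalIntegral.integral_pos hτ0 (hdc.mono (Set.Icc_subset_Icc le_rfl hτt))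
      · intro τ hτ
        exact hd0 τ ⟨hτ.1.le, hτ.2.trans hτt⟩
      · refine ⟨0, ⟨le_rfl, hτ0.le⟩, ?_⟩
        rw [F.start, F.start]
        linarith
    · refine (hK s hs s' hs' hss.le).trans ?_
      rw [hC, mul_assoc]
      refine mul_le_mul_of_nonneg_left ?_ hK0
      refine int_ratio hτ0 hτt hE hdc hd0 ?_
      intro p q hp hpq hq
      have := F.est s hs s' hs' p q hp hpq hq
      rwa [abs_of_nonneg (hd0 p ⟨hp, hpq.trans hq⟩),
        abs_of_nonneg (hd0 q ⟨hp.trans hpq, hq⟩)] at this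
    · have h1 := int_lower hτ0 hτt hφc (F.cont s) (F.cont s') (F.mem s hs) (F.mem s' hs')
        (F.mono s s' hss.le) hmono (near s hs hsr) (near s' hs' hsr') hlow
      refine h1.trans_eq ?_
      have h2 : ∀ s, ∫ τ in (0:ℝ)..t, φ (U τ s) = A (X s) := by
        intro s
        rw [clm_apply_sum A (X s)]
        simp only [φ]
        rw [intervalIntegral.integral_finsetSum]
        · refine Finset.sum_congr rfl fun i _ => ?_
          rw [hX, intervalIntegral.integral_const_mul]
        · intro i _
          exact ((((hf1 i).continuous).comp_continuousOn (F.cont s)).intervalIntegrable_of_Icc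
            ht.le).const_mul _
      rw [h2, h2, map_sub]
  -- differentiability
  have hdiff : HasFDerivAt M A y₀ := (hM.differentiable one_ne_zero y₀).hasFDerivAt
  set ε := c / (2 * (C + 1)) with hε
  have hε0 : 0 < ε := by positivity
  have hεC : ε * C < c := by
    rw [hε, div_mul_eq_mul_div, div_lt_iff₀ (by positivity)]
    nlinarith
  have hlit := (hasFDerivAt_iff_isLittleO_nhds_zero.mp hdiff).def hε0
  obtain ⟨η, hη, hball⟩ := Metric.eventually_nhds_iff.mp hlit
  refine ⟨min (ρ / 2 / (E + 1)) (η / (K' + 1)), by positivity, fun s hs h0 h1 => ?_⟩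
  have h1a := (lt_div_iff₀ (by positivity)).mp (lt_min_iff.mp h1).1
  have h1b := (lt_div_iff₀ (by positivity)).mp (lt_min_iff.mp h1).2
  have hsr : E * |s - r| ≤ ρ / 2 := by nlinarith
  have hrr : E * |r - r| ≤ ρ / 2 := by simp; linarith
  have hXs : ‖X s - X r‖ < η := by
    have := hK' r hrI s hs
    nlinarith
  have hMs := hball (y := -(X s - X r)) (by rw [dist_zero_right, norm_neg]; exact hXs)
  have e1 : y₀ + -(X s - X r) = z - X s := by rw [hy₀]; abel
  rw [e1, hz, map_neg, norm_neg, sub_zero, sub_neg_eq_add, Real.norm_eq_abs] at hMs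
  have hMs' := abs_le.mp hMs
  rcases lt_or_gt_of_ne (sub_ne_zero.mp (abs_pos.mp h0)) with hlt | hgt
  · obtain ⟨I, hI, hI1, hI2⟩ := pair s hs r hrI hlt hsr hrr
    rw [norm_sub_rev] at hI1
    have e2 : A (X r - X s) = - A (X s - X r) := by rw [← map_neg, neg_sub]
    rw [e2] at hI2
    have h3 : ε * ‖X s - X r‖ ≤ ε * (C * I) := mul_le_mul_of_nonneg_left hI1 hε0.le
    have h4 : ε * C * I < c * I := mul_lt_mul_of_pos_right hεC hI
    have : 0 < M (z - X s) := by linarith [hMs'.1]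
    exact mul_neg_of_neg_of_pos (by linarith) this
  · obtain ⟨I, hI, hI1, hI2⟩ := pair r hrI s hs hgt hrr hsr
    have h3 : ε * ‖X s - X r‖ ≤ ε * (C * I) := mul_le_mul_of_nonneg_left hI1 hε0.le
    have h4 : ε * C * I < c * I := mul_lt_mul_of_pos_right hεC hI
    have : M (z - X s) < 0 := by linarith [hMs'.2]
    exact mul_neg_of_pos_of_neg (by linarith) this

/-- Global sign claim from local crossings, uniform in the base point. -/
lemma global_sign {n : ℕ} {X : ℝ → Euc n} {M : Euc n → ℝ} (hM : Continuous M) {m₁ m₂ : ℝ}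
    (hXc : ContinuousOn X (Set.Icc m₁ m₂))
    (hc : ∀ z : Euc n, ∀ r ∈ Set.Ioo m₁ m₂, M (z - X r) = 0 → ∃ δ > 0, ∀ s ∈ Set.Icc m₁ m₂,
      0 < |s - r| → |s - r| < δ → (s - r) * M (z - X s) < 0)
    (x : Euc n) {s₀ : ℝ} (hs₀ : s₀ ∈ Set.Icc m₁ m₂) (h0 : M (x - X s₀) = 0) :
    ∀ s ∈ Set.Ioo m₁ m₂, s ≠ s₀ → (s - s₀) * M (x - X s) < 0 := by
  have hqc : ∀ z : Euc n, ContinuousOn (fun s => M (z - X s)) (Set.Icc m₁ m₂) := fun z =>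
    hM.comp_continuousOn (continuousOn_const.sub hXc)
  have hlim : ∀ s, ContinuousOn (fun σ => M ((x - X s₀ + X σ) - X s)) (Set.Icc m₁ m₂) := fun s =>
    hM.comp_continuousOn ((continuousOn_const.add hXc).sub continuousOn_const)
  have hval : ∀ s, M ((x - X s₀ + X s₀) - X s) = M (x - X s) := fun s => by
    congr 1; abel
  have hz : ∀ σ, M ((x - X s₀ + X σ) - X σ) = 0 := fun σ => by
    rw [add_sub_cancel_right]; exact h0
  have right : ∀ s ∈ Set.Ioo m₁ m₂, s₀ < s → M (x - X s) ≤ 0 := by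
    intro s hs hlt
    have hne : (nhdsWithin s₀ (Set.Ioo s₀ s)).NeBot := left_nhdsWithin_Ioo_neBot hlt
    have hT := ((hlim s) s₀ hs₀).mono (t := Set.Icc m₁ m₂) (s := Set.Ioo s₀ s)
      (fun y hy => ⟨hs₀.1.trans hy.1.le, by linarith [hy.2, hs.2]⟩)
    have hT' : Tendsto _ _ _ := hT
    simp only [hval] at hT'
    refine le_of_tendsto hT' ?_
    filter_upwards [self_mem_nhdsWithin] with σ hσ
    exact (cross_right (hqc _) (hc _) (σ := σ) ⟨hs₀.1.trans_lt hσ.1, hσ.2.trans hs.2⟩ hs hσ.2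
      (hz σ)).le
  have left : ∀ s ∈ Set.Ioo m₁ m₂, s < s₀ → 0 ≤ M (x - X s) := by
    intro s hs hlt
    have hne : (nhdsWithin s₀ (Set.Ioo s s₀)).NeBot := right_nhdsWithin_Ioo_neBot hlt
    have hT := ((hlim s) s₀ hs₀).mono (t := Set.Icc m₁ m₂) (s := Set.Ioo s s₀)
      (fun y hy => ⟨by linarith [hy.1, hs.1], hy.2.le.trans hs₀.2⟩)
    have hT' : Tendsto _ _ _ := hT
    simp only [hval] at hT'
    refine ge_of_tendsto hT' ?_
    filter_upwards [self_mem_nhdsWithin] with σ hσ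
    exact (cross_left (hqc _) (hc _) (σ := σ) ⟨hs.1.trans hσ.1, hσ.2.trans_le hs₀.2⟩ hs hσ.1
      (hz σ)).le
  intro s hs hne
  rcases lt_or_gt_of_ne hne with hlt | hgt
  · have hpos : 0 < M (x - X s) := by
      refine lt_of_le_of_ne (left s hs hlt) fun heq => ?_
      obtain ⟨y, hy1, hy2⟩ := exists_between (lt_min hlt hs.2)
      rw [lt_min_iff] at hy2
      have hyI : y ∈ Set.Ioo m₁ m₂ := ⟨hs.1.trans hy1, hy2.2⟩
      have := cross_right (hqc x) (hc x) hs hyI hy1 heq.symm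
      have := left y hyI hy2.1
      linarith
    exact mul_neg_of_neg_of_pos (by linarith) hpos
  · have hneg : M (x - X s) < 0 := by
      refine lt_of_le_of_ne (right s hs hgt) fun heq => ?_
      obtain ⟨y, hy1, hy2⟩ := exists_between (max_lt hgt hs.1)
      rw [max_lt_iff] at hy1
      have hyI : y ∈ Set.Ioo m₁ m₂ := ⟨hy1.2, hy2.trans hs.2⟩
      have := cross_left (hqc x) (hc x) hs hyI hy2 heq
      have := right y hyI hy1.1
      linarith
    exact mul_neg_of_pos_of_neg (by linarith) hneg

/-- the sign claim for `Q` in the proof of Lemma 6.1 of the paper.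
In the Riemann setup — `f_i ∈ C²`, `g` continuous, one-sided Lipschitz on compacts and
limsup-sublinear, `ū` the forward characteristic flow, `χ_i(t,s) = ∫₀^t f_i'(ū(τ,s)) dτ`,
`M ∈ C¹(ℝⁿ)`, and Condition (H) — fix `(t,x)` with `t > 0` and set
`Q(s) = M(x - χ(t,s))`.  If `s₀` lies between `uminus` and `uplus` and `Q(s₀) = 0`, then there
is `δ > 0` such that `(s - s₀) Q(s) < 0` for every `s` between `uminus` and `uplus` with
`0 < |s - s₀| < δ`. -/
theorem riemann_Q_sign
    (n : ℕ) (hn : 1 ≤ n)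
    (f : Fin n → ℝ → ℝ) (hf : ∀ i, ContDiff ℝ 2 (f i))
    (g : ℝ → ℝ) (hg : Continuous g) (hOSL : OSLCompact g) (hsub : SublinearLimsup g)
    (ub : ℝ → ℝ → ℝ) (hub : ∀ s : ℝ, IsForwardSol g s (fun t => ub t s))
    (χ : ℝ → ℝ → Euc n)
    (hχ : ∀ t s : ℝ, χ t s = (EuclideanSpace.equiv (Fin n) ℝ).symm
      (fun i => ∫ τ in (0:ℝ)..t, deriv (f i) (ub τ s)))
    (M : Euc n → ℝ) (hM : ContDiff ℝ 1 M)
    (uminus uplus a b : ℝ)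
    (ha : ∀ t : ℝ, 0 ≤ t → a ≤ min (ub t uminus) (ub t uplus))
    (hb : ∀ t : ℝ, 0 ≤ t → max (ub t uminus) (ub t uplus) ≤ b)
    (hH : ∀ x : Euc n, M x = 0 → ∀ w ∈ Set.Ioo a b,
      0 < ∑ i, fderiv ℝ M x (EuclideanSpace.single i 1) * deriv (deriv (f i)) w)
    (t : ℝ) (ht : 0 < t) (x : Euc n)
    (s₀ : ℝ) (hs₀ : s₀ ∈ Set.Icc (min uminus uplus) (max uminus uplus))
    (hQs₀ : M (x - χ t s₀) = 0) :
    ∃ δ : ℝ, 0 < δ ∧ ∀ s ∈ Set.Icc (min uminus uplus) (max uminus uplus),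
      0 < |s - s₀| → |s - s₀| < δ → (s - s₀) * M (x - χ t s) < 0 := by
  set m₁ := min uminus uplus with hm₁
  set m₂ := max uminus uplus with hm₂
  have hu0 : ∀ s, ub 0 s = s := fun s => (hub s).1
  rcases (hs₀.1.trans hs₀.2).eq_or_lt with heq | hlt
  · refine ⟨1, one_pos, fun s hs h1 _ => ?_⟩
    have : s - s₀ = 0 := by linarith [hs.1, hs.2, hs₀.1, hs₀.2]
    rw [this, abs_zero] at h1
    exact absurd h1 (lt_irrefl _)
  have ha' : a ≤ m₁ := by simpa [hu0, hm₁] using ha 0 le_rfl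
  have hb' : m₂ ≤ b := by simpa [hu0, hm₂] using hb 0 le_rfl
  have hmono : ∀ s s', s ≤ s' → ∀ τ, 0 ≤ τ → ub τ s ≤ ub τ s' := fun s s' hss τ hτ =>
    sol_mono hOSL (hub s).2 (hub s').2 (by simpa [hu0] using hss) hτ
  have hmem : ∀ s ∈ Set.Icc m₁ m₂, ∀ τ, 0 ≤ τ → ub τ s ∈ Set.Icc a b := by
    intro s hs τ hτ
    have h1 := ha τ hτ
    have h2 := hb τ hτ
    rw [le_min_iff] at h1
    rw [max_le_iff] at h2
    constructor
    · refine le_trans ?_ (hmono _ _ hs.1 τ hτ)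
      rcases min_choice uminus uplus with h | h
      · rw [hm₁, h]; exact h1.1
      · rw [hm₁, h]; exact h1.2
    · refine le_trans (hmono _ _ hs.2 τ hτ) ?_
      rcases max_choice uminus uplus with h | h
      · rw [hm₂, h]; exact h2.1
      · rw [hm₂, h]; exact h2.2
  obtain ⟨L, hL⟩ := hOSL a b (by linarith)
  have F : FlowData ub m₁ m₂ a b (Real.exp (|L| * t)) t := by
    refine ⟨ht, (Real.exp_pos _).le, hu0, fun s τ hτ => ?_, fun s hs τ hτ => hmem s hs τ hτ.1,
      fun s s' hss τ hτ => hmono s s' hss τ hτ.1, ?_⟩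
    · exact (((hub s).2 τ hτ.1).continuousWithinAt).mono (fun y hy => hy.1)
    · intro s hs s' hs' r τ hr hrτ hτt
      refine (osl_est (T := t) hL (hub s').2 (hub s).2 (fun τ hτ => hmem s' hs' τ hτ.1)
        (fun τ hτ => hmem s hs τ hτ.1) hr hrτ hτt).trans ?_
      refine mul_le_mul_of_nonneg_right (Real.exp_le_exp.mpr ?_) (abs_nonneg _)
      calc L * (τ - r) ≤ |L| * (τ - r) :=
            mul_le_mul_of_nonneg_right (le_abs_self L) (by linarith)
        _ ≤ |L| * t := mul_le_mul_of_nonneg_left (by linarith) (abs_nonneg L)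
  have hX : ∀ s i, χ t s i = ∫ τ in (0:ℝ)..t, deriv (f i) (ub τ s) := by
    intro s i
    rw [hχ]
    rfl
  have hXc : ContinuousOn (χ t) (Set.Icc m₁ m₂) := by
    obtain ⟨K, hK0, hK⟩ := chi_lip' hf F hX
    have : LipschitzOnWith ⟨K, hK0⟩ (χ t) (Set.Icc m₁ m₂) :=
      LipschitzOnWith.of_dist_le_mul fun s hs s' hs' => by
        rw [dist_eq_norm, Real.dist_eq]
        exact hK s' hs' s hs
    exact this.continuousOn
  have G := global_sign hM.continuous hXc (local_cross hf F ha' hb' hX hM hH) x hs₀ hQs₀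
  have fin : ∀ δ : ℝ, (∀ s ∈ Set.Icc m₁ m₂, 0 < |s - s₀| → |s - s₀| < δ → s ∈ Set.Ioo m₁ m₂) →
      ∀ s ∈ Set.Icc m₁ m₂, 0 < |s - s₀| → |s - s₀| < δ → (s - s₀) * M (x - χ t s) < 0 :=
    fun δ h s hs h1 h2 => G s (h s hs h1 h2) (sub_ne_zero.mp (abs_pos.mp h1))
  rcases hs₀.1.eq_or_lt with h | h
  · refine ⟨m₂ - m₁, by linarith, fin _ fun s hs h1 h2 => ?_⟩
    have h3 := abs_lt.mp h2
    refine ⟨lt_of_le_of_ne hs.1 fun h' => ?_, by linarith⟩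
    rw [← h', ← h, sub_self, abs_zero] at h1
    exact lt_irrefl _ h1
  · rcases hs₀.2.eq_or_lt with h' | h'
    · refine ⟨m₂ - m₁, by linarith, fin _ fun s hs h1 h2 => ?_⟩
      have h3 := abs_lt.mp h2
      refine ⟨by linarith, lt_of_le_of_ne hs.2 fun h'' => ?_⟩
      rw [h'', h', sub_self, abs_zero] at h1
      exact lt_irrefl _ h1
    · refine ⟨min (s₀ - m₁) (m₂ - s₀), lt_min (by linarith) (by linarith),
        fin _ fun s hs h1 h2 => ?_⟩
      rw [lt_min_iff] at h2
      have h3 := abs_lt.mp h2.1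
      have h4 := abs_lt.mp h2.2
      exact ⟨by linarith, by linarith⟩
end
end

section
/- Consider the Riemann setup: f_i ∈ C²(ℝ) for i = 1,…,n; g : ℝ → ℝ continuous, one-sided Lipschitz on every compact interval, with limsup_{η→±∞} g(η)/η < ∞; ū(t,s) the unique forward solution of dū/dt = g(ū), ū(0,s) = s; χ_i(t,s) := ∫₀^t f_i'(ū(τ,s)) dτ and χ(t,s) := (χ₁(t,s),…,χₙ(t,s)); M ∈ C¹(ℝⁿ); and Condition (H): for every x ∈ ℝⁿ with M(x) = 0 and every u ∈ (a,b), Σ_{i=1}^n ∂M/∂x_i(x) f_i''(u) > 0, where a ≤ inf_{t≥0} min{ū(t,u₋), ū(t,u₊)} and b ≥ sup_{t≥0} max{ū(t,u₋), ū(t,u₊)}. If u₋ > u₊, then the open sets Ω₋ := {(t,x) : t > 0, M(x − χ(t,u₋)) < 0} and Ω₊ := {(t,x) : t > 0, M(x − χ(t,u₊)) > 0} have nonempty intersection; that is, there exists (t,x) with t > 0 such that M(x − χ(t,u₋)) < 0 and M(x − χ(t,u₊)) > 0. Consequently the characteristics emitting from the two sides of the initial discontinuity intersect, and the Riemann solution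 cannot be continuous. -/
open Set Filter MeasureTheory

noncomputable section

open Topology in
lemma eventually_pos_of_right_deriv {φ : ℝ → ℝ} {c : ℝ}
    (h : HasDerivWithinAt φ c (Set.Ici 0) 0) (h0 : φ 0 = 0) (hc : 0 < c) :
    ∀ᶠ t in 𝓝[>] (0:ℝ), 0 < φ t := by
  have h1 : HasDerivWithinAt φ c (Set.Ioi 0) 0 := h.mono Set.Ioi_subset_Ici_self
  rw [hasDerivWithinAt_iff_tendsto_slope' (by simp)] at h1
  filter_upwards [h1.eventually (lt_mem_nhds hc), self_mem_nhdsWithin] with t ht ht0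
  have ht0' : (0:ℝ) < t := ht0
  rw [slope_def_field, h0, sub_zero, sub_zero] at ht
  exact (div_pos_iff_of_pos_right ht0').1 ht

/-- Lemma 6.1(i) of the paper.  In the Riemann setup with Condition
(H), if `u₋ > u₊` then the open sets `Ω₋ = {(t,x) : t > 0, M(x - χ(t,u₋)) < 0}` and
`Ω₊ = {(t,x) : t > 0, M(x - χ(t,u₊)) > 0}` intersect: the characteristics emitting from
the two sides of the initial discontinuity intersect, so the Riemann solution cannot be
continuous. -/
theorem riemann_characteristics_intersect
    (n : ℕ) (hn : 1 ≤ n)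
    (f : Fin n → ℝ → ℝ) (hf : ∀ i, ContDiff ℝ 2 (f i))
    (g : ℝ → ℝ) (hg : Continuous g) (hOSL : OSLCompact g) (hsub : SublinearLimsup g)
    (ub : ℝ → ℝ → ℝ) (hub : ∀ s : ℝ, IsForwardSol g s (fun t => ub t s))
    (χ : ℝ → ℝ → Euc n)
    (hχ : ∀ t s : ℝ, χ t s = (EuclideanSpace.equiv (Fin n) ℝ).symm
      (fun i => ∫ τ in (0:ℝ)..t, deriv (f i) (ub τ s)))
    (M : Euc n → ℝ) (hM : ContDiff ℝ 1 M)
    (hMneg : ∃ x : Euc n, M x < 0) (hMpos : ∃ x : Euc n, 0 < M x)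
    (uminus uplus a b : ℝ)
    (ha : ∀ t : ℝ, 0 ≤ t → a ≤ min (ub t uminus) (ub t uplus))
    (hb : ∀ t : ℝ, 0 ≤ t → max (ub t uminus) (ub t uplus) ≤ b)
    (hH : ∀ x : Euc n, M x = 0 → ∀ w ∈ Set.Ioo a b,
      0 < ∑ i, fderiv ℝ M x (EuclideanSpace.single i 1) * deriv (deriv (f i)) w)
    (hu : uplus < uminus) :
    ∃ t : ℝ, ∃ x : Euc n, 0 < t ∧
      M (x - χ t uminus) < 0 ∧ 0 < M (x - χ t uplus) := by
  have hd1 : ∀ i, Differentiable ℝ (deriv (f i)) := by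
    intro i
    have h2 : ContDiff ℝ (1 + 1) (f i) := by
      have := hf i
      norm_num
      exact this
    exact ((contDiff_succ_iff_deriv.1 h2).2.2).differentiable (by norm_num)
  -- a zero of M
  obtain ⟨x0, hx0⟩ : ∃ x, M x = 0 := by
    obtain ⟨p, hp⟩ := hMneg
    obtain ⟨q, hq⟩ := hMpos
    exact mem_range_of_exists_le_of_exists_ge hM.continuous ⟨p, hp.le⟩ ⟨q, hq.le⟩
  -- the initial relative velocity
  let V : Euc n := (EuclideanSpace.equiv (Fin n) ℝ).symm
    (fun i => deriv (f i) uminus - deriv (f i) uplus)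
  have hMd : HasFDerivAt M (fderiv ℝ M x0) x0 :=
    (hM.differentiable (by norm_num) x0).hasFDerivAt
  have hub0 : ∀ s, ub 0 s = s := fun s => (hub s).1
  have hap : a ≤ uplus := by
    have := ha 0 le_rfl
    rw [hub0, hub0] at this
    exact this.trans (min_le_right _ _)
  have hbm : uminus ≤ b := by
    have := hb 0 le_rfl
    rw [hub0, hub0] at this
    exact (le_max_left _ _).trans this
  have hV : 0 < fderiv ℝ M x0 V := by
    have hVs : V = ∑ i, (deriv (f i) uminus - deriv (f i) uplus) •
        (EuclideanSpace.single i (1:ℝ) : Euc n) := by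
      ext j
      simp [V, Finset.sum_apply, Pi.single_apply]
    have hmono : StrictMonoOn (fun w => ∑ i, fderiv ℝ M x0 (EuclideanSpace.single i 1) *
        deriv (f i) w) (Set.Icc uplus uminus) := by
      have hder : ∀ w, HasDerivAt (fun w => ∑ i, fderiv ℝ M x0 (EuclideanSpace.single i 1) *
        deriv (f i) w) (∑ i, fderiv ℝ M x0 (EuclideanSpace.single i 1) *
          deriv (deriv (f i)) w) w := by
        intro w
        exact HasDerivAt.fun_sum fun i _ => ((hd1 i w).hasDerivAt).const_mul _
      refine strictMonoOn_of_deriv_pos (convex_Icc _ _)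
        (fun w _ => (hder w).continuousAt.continuousWithinAt) ?_
      intro w hw
      rw [interior_Icc] at hw
      rw [(hder w).deriv]
      exact hH x0 hx0 w ⟨hap.trans_lt hw.1, hw.2.trans_le hbm⟩
    have h := hmono (Set.left_mem_Icc.2 hu.le) (Set.right_mem_Icc.2 hu.le) hu
    rw [hVs, map_sum]
    simp only [map_smul, smul_eq_mul]
    have h' := sub_pos.2 h
    simp only [← Finset.sum_sub_distrib] at h'
    refine h'.trans_eq (Finset.sum_congr rfl fun i _ => by ring)
  -- right derivative of characteristics
  have hχd : ∀ s, HasDerivWithinAt (fun t => χ t s)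
      ((EuclideanSpace.equiv (Fin n) ℝ).symm (fun i => deriv (f i) s)) (Set.Ici 0) 0 := by
    intro s
    have hc : ContinuousOn (fun t => ub t s) (Set.Ici 0) :=
      fun t ht => ((hub s).2 t ht).continuousWithinAt
    have hpi : HasDerivWithinAt (fun t => fun i => ∫ τ in (0:ℝ)..t, deriv (f i) (ub τ s))
        (fun i => deriv (f i) s) (Set.Ici 0) 0 := by
      rw [hasDerivWithinAt_pi]
      intro i
      have hci : ContinuousOn (fun t => deriv (f i) (ub t s)) (Set.Ici 0) :=
        (hd1 i).continuous.comp_continuousOn hc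
      have := intervalIntegral.integral_hasDerivWithinAt_right (a := 0) (b := 0)
        (s := Set.Ici 0) (t := Set.Ioi 0)
        (f := fun t => deriv (f i) (ub t s)) (by simp)
        ⟨Set.Ioi 0, self_mem_nhdsWithin,
          (hci.mono Set.Ioi_subset_Ici_self).aestronglyMeasurable measurableSet_Ioi⟩
        ((hci 0 (by simp)).mono Set.Ioi_subset_Ici_self)
      simpa only [hub0] using this
    have h := ((EuclideanSpace.equiv (Fin n) ℝ).symm.toContinuousLinearMap.hasFDerivAt
      ).comp_hasDerivWithinAt (0:ℝ) hpi
    refine h.congr_of_mem (fun t _ => hχ t s) (by simp)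
  have hχ0 : ∀ s, χ 0 s = 0 := by
    intro s
    rw [hχ]
    ext i
    simp
  have hDd : HasDerivWithinAt (fun t => x0 + (χ t uminus - χ t uplus)) V (Set.Ici 0) 0 := by
    have h := ((hχd uminus).sub (hχd uplus)).const_add x0
    rw [← map_sub] at h
    exact h
  have hMD : HasDerivWithinAt (fun t => M (x0 + (χ t uminus - χ t uplus)))
      (fderiv ℝ M x0 V) (Set.Ici 0) 0 :=
    HasFDerivAt.comp_hasDerivWithinAt_of_eq (0:ℝ) hMd hDd (by simp [hχ0])
  have hE : HasDerivWithinAt (fun t : ℝ => x0 - t • V) (-V) (Set.Ici 0) 0 := by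
    have := ((hasDerivAt_id (0:ℝ)).smul_const V).const_sub x0
    simpa using this.hasDerivWithinAt
  have hME : HasDerivWithinAt (fun t : ℝ => - M (x0 - t • V))
      (fderiv ℝ M x0 V) (Set.Ici 0) 0 := by
    have := (HasFDerivAt.comp_hasDerivWithinAt_of_eq (0:ℝ) hMd hE (by simp)).neg
    rw [map_neg, neg_neg] at this
    exact this
  obtain ⟨t, ht, ht0⟩ := ((eventually_pos_of_right_deriv hMD (by simp [hχ0, hx0]) hV).and
    self_mem_nhdsWithin).exists
  have hcont : Continuous fun ε : ℝ => M (x0 - ε • V + (χ t uminus - χ t uplus)) :=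
    hM.continuous.comp (by fun_prop)
  have hev := (hcont.tendsto 0).eventually (lt_mem_nhds (a := 0) (by simpa using ht))
  obtain ⟨ε, h1, h2⟩ := ((eventually_pos_of_right_deriv hME (by simp [hx0]) hV).and
    (hev.filter_mono nhdsWithin_le_nhds)).exists
  refine ⟨t, x0 - ε • V + χ t uminus, ht0, ?_, ?_⟩
  · rw [add_sub_cancel_right]
    linarith
  · rw [add_sub_assoc]
    exact h2
end
end

section
/- Consider the Riemann setup: f_i ∈ C²(ℝ) for i = 1,…,n; g : ℝ → ℝ continuous, one-sided Lipschitz on every compact interval, with limsup_{η→±∞} g(η)/η < ∞; ū(t,s) the unique forward solution of dū/dt = g(ū), ū(0,s) = s; χ_i(t,s) := ∫₀^t f_i'(ū(τ,s)) dτ and χ(t,s) := (χ₁(t,s),…,χₙ(t,s)); M ∈ C¹(ℝⁿ); and Condition (H): for every x ∈ ℝⁿ with M(x) = 0 and every u ∈ (a,b), Σ_{i=1}^n ∂M/∂x_i(x) f_i''(u) > 0, where a ≤ inf_{t≥0} min{ū(t,u₋), ū(t,u₊)} and b ≥ sup_{t≥0} max{ū(t,u₋), ū(t,u₊)}. If u₋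 < u₊, then the sets Ω₋ := {(t,x) : t > 0, M(x − χ(t,u₋)) < 0} and Ω₊ := {(t,x) : t > 0, M(x − χ(t,u₊)) > 0} are disjoint: there is no (t,x) with t > 0 such that both M(x − χ(t,u₋)) < 0 and M(x − χ(t,u₊)) > 0. Consequently the characteristics emitting from the two sides of the initial discontinuity do not intersect. -/
open Set Filter MeasureTheory

noncomputable section

lemma aux_order (g : ℝ → ℝ) (hOSL : OSLCompact g) (p q : ℝ → ℝ) (s r : ℝ)
    (hp : IsForwardSol g s p) (hq : IsForwardSol g r q) (hsr : s < r)
    (t : ℝ) (ht : 0 ≤ t) : p t ≤ q t := by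
  by_contra! hlt
  have hpc : ContinuousOn p (Ici 0) := fun τ hτ => (hp.2 τ hτ).continuousWithinAt
  have hqc : ContinuousOn q (Ici 0) := fun τ hτ => (hq.2 τ hτ).continuousWithinAt
  have hsubs : Icc 0 t ⊆ Ici (0:ℝ) := fun τ hτ => hτ.1
  have hdc : ContinuousOn (fun τ => p τ - q τ) (Icc 0 t) := (hpc.sub hqc).mono hsubs
  -- the set of times where p ≤ q
  set S : Set ℝ := Icc 0 t ∩ (fun τ => p τ - q τ) ⁻¹' Iic 0 with hS
  have hScl : IsClosed S := hdc.preimage_isClosed_of_isClosed isClosed_Icc isClosed_Iic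
  have hScp : IsCompact S := isCompact_Icc.of_isClosed_subset hScl inter_subset_left
  have hSne : S.Nonempty := ⟨0, ⟨le_rfl, ht⟩, by
    simp only [mem_preimage, mem_Iic]; rw [hp.1, hq.1]; linarith⟩
  obtain ⟨t0, ht0⟩ := hScp.exists_isGreatest hSne
  obtain ⟨⟨ht0I, ht0le⟩, hup⟩ := ht0
  simp only [mem_preimage, mem_Iic] at ht0le
  have ht0t : t0 < t := by
    rcases lt_or_eq_of_le ht0I.2 with h | h
    · exact h
    · subst h; linarith
  have hpos : ∀ τ ∈ Ioc t0 t, 0 < p τ - q τ := by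
    intro τ hτ
    by_contra! hc
    have : τ ≤ t0 := hup ⟨⟨ht0I.1.trans hτ.1.le, hτ.2⟩, hc⟩
    linarith [hτ.1]
  -- bounds
  obtain ⟨A, hA⟩ := (isCompact_Icc.image_of_continuousOn (hpc.mono hsubs)).isBounded.subset_closedBall 0
  obtain ⟨B, hB⟩ := (isCompact_Icc.image_of_continuousOn (hqc.mono hsubs)).isBounded.subset_closedBall 0
  set C := max 1 (max A B) with hC
  have hC1 : 1 ≤ C := le_max_left _ _
  have hCA : A ≤ C := (le_max_left _ _).trans (le_max_right _ _)
  have hCB : B ≤ C := (le_max_right _ _).trans (le_max_right _ _)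
  have hpI : ∀ τ ∈ Icc 0 t, p τ ∈ Icc (-C) C := by
    intro τ hτ
    have := hA (mem_image_of_mem p hτ)
    rw [mem_closedBall_zero_iff, Real.norm_eq_abs, abs_le] at this
    constructor <;> linarith [this.1, this.2]
  have hqI : ∀ τ ∈ Icc 0 t, q τ ∈ Icc (-C) C := by
    intro τ hτ
    have := hB (mem_image_of_mem q hτ)
    rw [mem_closedBall_zero_iff, Real.norm_eq_abs, abs_le] at this
    constructor <;> linarith [this.1, this.2]
  obtain ⟨L, hL⟩ := hOSL (-C) C (by linarith)
  have hanti : AntitoneOn (fun τ => Real.exp (-(L * τ)) * (p τ - q τ)) (Icc t0 t) := by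
    have hder : ∀ τ ∈ Ioo t0 t, HasDerivAt (fun τ => Real.exp (-(L * τ)) * (p τ - q τ))
        (Real.exp (-(L * τ)) * (-(L * 1)) * (p τ - q τ)
          + Real.exp (-(L * τ)) * (g (p τ) - g (q τ))) τ := by
      intro τ hτ
      have h0 : 0 < τ := ht0I.1.trans_lt hτ.1
      have h1 := (hp.2 τ h0.le).hasDerivAt (Ici_mem_nhds h0)
      have h2 := (hq.2 τ h0.le).hasDerivAt (Ici_mem_nhds h0)
      exact (((hasDerivAt_id τ).const_mul L).neg.exp).mul (h1.sub h2)
    apply antitoneOn_of_deriv_nonpos (convex_Icc _ _)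
    · apply ContinuousOn.mul (by fun_prop)
      exact hdc.mono (Icc_subset_Icc_left ht0I.1)
    · rw [interior_Icc]
      exact fun τ hτ => (hder τ hτ).differentiableAt.differentiableWithinAt
    · rw [interior_Icc]
      intro τ hτ
      rw [(hder τ hτ).deriv]
      have hτI : τ ∈ Icc 0 t := ⟨ht0I.1.trans hτ.1.le, hτ.2.le⟩
      have hd := hpos τ ⟨hτ.1, hτ.2.le⟩
      have h3 := hL (p τ) (hpI τ hτI) (q τ) (hqI τ hτI) (by intro h; linarith)
      rw [div_le_iff₀ hd] at h3
      have := Real.exp_pos (-(L * τ))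
      nlinarith
  have h4 := hanti ⟨le_rfl, ht0t.le⟩ ⟨ht0t.le, le_rfl⟩ ht0t.le
  simp only at h4
  have h5 : 0 < Real.exp (-(L * t)) * (p t - q t) := mul_pos (Real.exp_pos _) (by linarith)
  have h6 : Real.exp (-(L * t0)) * (p t0 - q t0) ≤ 0 :=
    mul_nonpos_of_nonneg_of_nonpos (Real.exp_pos _).le ht0le
  linarith

lemma aux_cross (h h' : ℝ → ℝ) (hd : ∀ θ, HasDerivAt h (h' θ) θ)
    (hz : ∀ θ, h θ = 0 → h' θ < 0) (h0 : h 0 < 0) (h1 : 0 < h 1) : False := by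
  have hc : Continuous h := continuous_iff_continuousAt.2 fun θ => (hd θ).continuousAt
  set S : Set ℝ := Icc 0 1 ∩ h ⁻¹' Iic 0 with hS
  have hScp : IsCompact S := isCompact_Icc.inter_right (isClosed_Iic.preimage hc)
  obtain ⟨c, ⟨hcI, hcle⟩, hup⟩ := hScp.exists_isGreatest ⟨0, ⟨le_rfl, zero_le_one⟩, h0.le⟩
  simp only [mem_preimage, mem_Iic] at hcle
  have hc1 : c < 1 := by
    rcases lt_or_eq_of_le hcI.2 with h | h
    · exact h
    · subst h; linarith
  have hpos : ∀ τ ∈ Ioc c 1, 0 < h τ := by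
    intro τ hτ
    by_contra! hn
    have : τ ≤ c := hup ⟨⟨hcI.1.trans hτ.1.le, hτ.2⟩, hn⟩
    linarith [hτ.1]
  have hev : ∀ᶠ τ in nhdsWithin c (Ioi c), 0 < h τ := by
    filter_upwards [Ioc_mem_nhdsGT hc1] with τ hτ using hpos τ hτ
  have hge : 0 ≤ h c := ge_of_tendsto (hc.continuousAt.tendsto.mono_left nhdsWithin_le_nhds)
    (hev.mono fun _ h => h.le)
  have hc0 : h c = 0 := le_antisymm hcle hge
  have hneg := hz c hc0
  have hsl := (hasDerivAt_iff_tendsto_slope.1 (hd c)).mono_left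
    (nhdsWithin_mono c (fun x (hx : x ∈ Ioi c) => (ne_of_gt hx : x ≠ c)))
  have : 0 ≤ h' c := by
    refine ge_of_tendsto hsl ?_
    filter_upwards [hev, self_mem_nhdsWithin] with τ hτ hτc
    rw [slope_def_field, hc0, sub_zero]
    exact div_nonneg hτ.le (sub_nonneg.2 (le_of_lt hτc))
  linarith

/-- Lemma 6.1(ii) of the paper.  In the Riemann setup with Condition
(H), if `u₋ < u₊` then the sets `Ω₋ = {(t,x) : t > 0, M(x - χ(t,u₋)) < 0}` and
`Ω₊ = {(t,x) : t > 0, M(x - χ(t,u₊)) > 0}` are disjoint: the characteristics emitting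
from the two sides of the initial discontinuity do not intersect. -/
theorem riemann_characteristics_disjoint
    (n : ℕ) (hn : 1 ≤ n)
    (f : Fin n → ℝ → ℝ) (hf : ∀ i, ContDiff ℝ 2 (f i))
    (g : ℝ → ℝ) (hg : Continuous g) (hOSL : OSLCompact g) (hsub : SublinearLimsup g)
    (ub : ℝ → ℝ → ℝ) (hub : ∀ s : ℝ, IsForwardSol g s (fun t => ub t s))
    (χ : ℝ → ℝ → Euc n)
    (hχ : ∀ t s : ℝ, χ t s = (EuclideanSpace.equiv (Fin n) ℝ).symm
      (fun i => ∫ τ in (0:ℝ)..t, deriv (f i) (ub τ s)))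
    (M : Euc n → ℝ) (hM : ContDiff ℝ 1 M)
    (uminus uplus a b : ℝ)
    (ha : ∀ t : ℝ, 0 ≤ t → a ≤ min (ub t uminus) (ub t uplus))
    (hb : ∀ t : ℝ, 0 ≤ t → max (ub t uminus) (ub t uplus) ≤ b)
    (hH : ∀ x : Euc n, M x = 0 → ∀ w ∈ Set.Ioo a b,
      0 < ∑ i, fderiv ℝ M x (EuclideanSpace.single i 1) * deriv (deriv (f i)) w)
    (hu : uminus < uplus) :
    ¬ ∃ t : ℝ, ∃ x : Euc n, 0 < t ∧
        M (x - χ t uminus) < 0 ∧ 0 < M (x - χ t uplus) := by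
  rintro ⟨t, x, ht, hneg, hpos⟩
  have hord : ∀ τ, 0 ≤ τ → ub τ uminus ≤ ub τ uplus := fun τ hτ =>
    aux_order g hOSL _ _ _ _ (hub uminus) (hub uplus) hu τ hτ
  have hubc : ∀ s, ContinuousOn (fun τ => ub τ s) (Icc 0 t) := fun s τ hτ =>
    ((hub s).2 τ hτ.1).continuousWithinAt.mono (fun _ h => h.1)
  have hfd : ∀ i, ContDiff ℝ 1 (deriv (f i)) := fun i =>
    ((contDiff_succ_iff_deriv (n := 1)).1 (by simpa [one_add_one_eq_two] using hf i)).2.2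
  have hfc : ∀ i s, ContinuousOn (fun τ => deriv (f i) (ub τ s)) (Icc 0 t) := fun i s =>
    (hfd i).continuous.comp_continuousOn (hubc s)
  have hfi : ∀ i s, IntervalIntegrable (fun τ => deriv (f i) (ub τ s)) volume 0 t := fun i s =>
    ContinuousOn.intervalIntegrable (by rw [uIcc_of_le ht.le]; exact hfc i s)
  -- the key sign
  have key : ∀ y : Euc n, M y = 0 → 0 < fderiv ℝ M y (χ t uplus - χ t uminus) := by
    intro y hy
    have hF : StrictMonoOn (fun w => ∑ i, fderiv ℝ M y (EuclideanSpace.single i 1)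
        * deriv (f i) w) (Icc a b) := by
      have hder : ∀ w, HasDerivAt (fun w => ∑ i, fderiv ℝ M y (EuclideanSpace.single i 1)
        * deriv (f i) w) (∑ i, fderiv ℝ M y (EuclideanSpace.single i 1)
          * deriv (deriv (f i)) w) w := by
        intro w
        apply HasDerivAt.fun_sum
        intro i _
        exact (((hfd i).differentiable one_ne_zero) w).hasDerivAt.const_mul _
      apply strictMonoOn_of_deriv_pos (convex_Icc _ _)
      · exact fun w _ => (hder w).continuousAt.continuousWithinAt
      · rw [interior_Icc]
        intro w hw
        rw [(hder w).deriv]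
        exact hH y hy w hw
    have hmem1 : ∀ τ, 0 ≤ τ → ub τ uminus ∈ Icc a b := fun τ hτ =>
      ⟨(ha τ hτ).trans (min_le_left _ _), (le_max_left _ _).trans (hb τ hτ)⟩
    have hmem2 : ∀ τ, 0 ≤ τ → ub τ uplus ∈ Icc a b := fun τ hτ =>
      ⟨(ha τ hτ).trans (min_le_right _ _), (le_max_right _ _).trans (hb τ hτ)⟩
    have hint : 0 < ∫ τ in (0:ℝ)..t, ∑ i, fderiv ℝ M y (EuclideanSpace.single i 1)
        * (deriv (f i) (ub τ uplus) - deriv (f i) (ub τ uminus)) := by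
      apply intervalIntegral.integral_pos ht
      · apply continuousOn_finsetSum
        intro i _
        exact continuousOn_const.mul ((hfc i _).sub (hfc i _))
      · intro τ hτ
        have := hF.monotoneOn (hmem1 τ hτ.1.le) (hmem2 τ hτ.1.le) (hord τ hτ.1.le)
        simp only [mul_sub, Finset.sum_sub_distrib]
        linarith
      · refine ⟨0, ⟨le_rfl, ht.le⟩, ?_⟩
        have e1 : ub 0 uminus = uminus := (hub uminus).1
        have e2 : ub 0 uplus = uplus := (hub uplus).1
        have := hF (hmem1 0 le_rfl) (hmem2 0 le_rfl) (by rw [e1, e2]; exact hu)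
        simp only [mul_sub, Finset.sum_sub_distrib]
        simp only at this
        linarith
    rw [intervalIntegral.integral_finsetSum
      (fun i _ => ((hfi i _).sub (hfi i _)).const_mul _)] at hint
    have hdec : χ t uplus - χ t uminus = ∑ i, (∫ τ in (0:ℝ)..t,
        (deriv (f i) (ub τ uplus) - deriv (f i) (ub τ uminus))) •
          (EuclideanSpace.single i (1:ℝ) : Euc n) := by
      ext j
      rw [hχ, hχ]
      simp [intervalIntegral.integral_sub (hfi j uplus) (hfi j uminus), Pi.single_apply]
    rw [hdec, map_sum]
    convert hint using 2 with i
    rw [map_smul, intervalIntegral.integral_const_mul, smul_eq_mul, mul_comm]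
  refine aux_cross (fun θ => M (x - χ t uminus - θ • (χ t uplus - χ t uminus)))
    (fun θ => fderiv ℝ M (x - χ t uminus - θ • (χ t uplus - χ t uminus))
      (-(χ t uplus - χ t uminus))) ?_ ?_ ?_ ?_
  · intro θ
    have h1 : HasDerivAt (fun θ : ℝ => x - χ t uminus - θ • (χ t uplus - χ t uminus))
        (-(χ t uplus - χ t uminus)) θ := by
      simpa using ((hasDerivAt_id θ).smul_const (χ t uplus - χ t uminus)).const_sub
        (x - χ t uminus)
    exact ((hM.differentiable one_ne_zero) _).hasFDerivAt.comp_hasDerivAt θ h1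
  · intro θ hθ
    have := key _ hθ
    rw [map_neg]
    linarith
  · simpa using hneg
  · simpa using hpos
end
end
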